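/- arXiv:2212.00781 — 11 statements merged into one kernel-verified Lean document; each statement's English description precedes it below -/
import Mathlib

section
/- Let x, z ∈ E, M > 0, and let T be a lazy cubic Newton step T_M(x, z) with r := ‖T − x‖. Then ‖∇f(T)‖ ≤ ((M + L)/2)·r² + L·r·‖z − x‖. -/
open scoped InnerProductSpace

/-- The first-order Taylor remainder of a map whose derivative is `L`-Lipschitz is at most
`L / 2 * ‖d‖ ^ 2`. -/
theorem norm_taylor_remainder_le_of_lipschitz_fderiv
    {E F : Type*} [NormedAddCommGroup E] [NormedSpace ℝ E] [NormedAddCommGroup F]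
    [NormedSpace ℝ F] {g : E → F} {H : E → E →L[ℝ] F} {L : ℝ}
    (hH : ∀ y, HasFDerivAt g (H y) y)
    (hLip : ∀ y₁ y₂, ‖H y₁ - H y₂‖ ≤ L * ‖y₁ - y₂‖) (x d : E) :
    ‖g (x + d) - g x - H x d‖ ≤ L / 2 * ‖d‖ ^ 2 := by
  have hderiv : ∀ t : ℝ, HasDerivAt (fun t : ℝ => g (x + t • d) - g x - t • H x d)
      (H (x + t • d) d - H x d) t := by
    intro t
    have hline : HasDerivAt (fun t : ℝ => x + t • d) d t := by
      simpa using ((hasDerivAt_id t).smul_const d).const_add x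
    have hlin : HasDerivAt (fun t : ℝ => t • H x d) (H x d) t := by
      simpa using (hasDerivAt_id t).smul_const (H x d)
    exact (((hH _).comp_hasDerivAt t hline).sub_const (g x)).sub hlin
  have hB : ∀ t : ℝ, HasDerivAt (fun t : ℝ => L / 2 * ‖d‖ ^ 2 * t ^ 2) (L * ‖d‖ ^ 2 * t) t := by
    intro t
    refine ((hasDerivAt_pow 2 t).const_mul (L / 2 * ‖d‖ ^ 2)).congr_deriv ?_
    push_cast
    ring
  have key := image_norm_le_of_norm_deriv_right_le_deriv_boundary (a := 0) (b := 1)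
    (fun t _ => (hderiv t).continuousAt.continuousWithinAt)
    (fun t _ => (hderiv t).hasDerivWithinAt) (by simp) hB
    (fun t ht => by
      have hnorm : ‖x + t • d - x‖ = t * ‖d‖ := by
        rw [add_sub_cancel_left, norm_smul, Real.norm_of_nonneg ht.1]
      calc ‖H (x + t • d) d - H x d‖ = ‖(H (x + t • d) - H x) d‖ := by simp
        _ ≤ ‖H (x + t • d) - H x‖ * ‖d‖ := ContinuousLinearMap.le_opNorm _ _
        _ ≤ L * (t * ‖d‖) * ‖d‖ := by
          gcongr
          exact hnorm ▸ hLip (x + t • d) x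
        _ = L * ‖d‖ ^ 2 * t := by ring)
    (Set.right_mem_Icc.2 zero_le_one)
  simpa using key

theorem lazy_cubic_grad_bound
    {E : Type*} [NormedAddCommGroup E] [InnerProductSpace ℝ E] [FiniteDimensional ℝ E]
    (f : E → ℝ) (g : E → E) (H : E → E →L[ℝ] E) (L : ℝ)
    (hL : 0 < L) (hf : ContDiff ℝ 2 f)
    (hg : ∀ y, HasGradientAt f (g y) y)
    (hH : ∀ y, HasFDerivAt g (H y) y)
    (hsym : ∀ y u v, ⟪H y u, v⟫_ℝ = ⟪u, H y v⟫_ℝ)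
    (hLip : ∀ y₁ y₂, ‖H y₁ - H y₂‖ ≤ L * ‖y₁ - y₂‖)
    (x z T : E) (M r : ℝ) (hr : r = ‖T - x‖)
    (hstat : g x + H z (T - x) + (M * r / 2) • (T - x) = 0)
    (hpsd : ∀ h : E, 0 ≤ ⟪H z h, h⟫_ℝ + M * r / 2 * ‖h‖ ^ 2)
    (hM : 0 < M) :
    ‖g T‖ ≤ (M + L) / 2 * r ^ 2 + L * r * ‖z - x‖ := by
  have htaylor := norm_taylor_remainder_le_of_lipschitz_fderiv hH hLip x (T - x)
  rw [add_sub_cancel, ← hr] at htaylor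
  have hr0 : 0 ≤ r := hr ▸ norm_nonneg _
  have hlazy : ‖(H x - H z) (T - x)‖ ≤ L * r * ‖z - x‖ := by
    calc ‖(H x - H z) (T - x)‖ ≤ ‖H x - H z‖ * ‖T - x‖ := ContinuousLinearMap.le_opNorm _ _
      _ ≤ L * ‖x - z‖ * ‖T - x‖ := by
        gcongr
        exact hLip x z
      _ = L * r * ‖z - x‖ := by rw [norm_sub_rev x z, ← hr]; ring
  have hreg : ‖(M * r / 2) • (T - x)‖ = M / 2 * r ^ 2 := by
    rw [norm_smul, Real.norm_of_nonneg (by positivity), ← hr]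
    ring
  have hdecomp : g T = (g T - g x - H x (T - x)) + (H x - H z) (T - x)
      - (M * r / 2) • (T - x) := by
    rw [sub_apply]
    linear_combination (norm := module) hstat
  calc ‖g T‖ = ‖(g T - g x - H x (T - x)) + (H x - H z) (T - x) - (M * r / 2) • (T - x)‖ :=
        congrArg norm hdecomp
    _ ≤ ‖g T - g x - H x (T - x)‖ + ‖(H x - H z) (T - x)‖ + ‖(M * r / 2) • (T - x)‖ :=
        (norm_sub_le _ _).trans (by gcongr; exact norm_add_le _ _)
    _ ≤ L / 2 * r ^ 2 + L * r * ‖z - x‖ + M / 2 * r ^ 2 := by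
        rw [hreg]
        gcongr
    _ = (M + L) / 2 * r ^ 2 + L * r * ‖z - x‖ := by ring
end

section
/- Let x, z ∈ E, M > 0, and let T be a lazy cubic Newton step T_M(x, z) with r := ‖T − x‖. Then f(x) − f(T) ≥ ((5M − 4L)/24)·r³ − (32·L³/(3·M²))·‖z − x‖³. -/
open scoped InnerProductSpace

lemma nonpos_of_hasDerivAt_nonpos {φ φ' : ℝ → ℝ} (h0 : φ 0 = 0)
    (hφ : ∀ t, HasDerivAt φ (φ' t) t) (hφ' : ∀ t, 0 ≤ t → φ' t ≤ 0) {t : ℝ} (ht : 0 ≤ t) :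
    φ t ≤ 0 := by
  have hanti : AntitoneOn φ (Set.Ici 0) := by
    refine antitoneOn_of_deriv_nonpos (convex_Ici 0)
      (fun s _ => (hφ s).continuousAt.continuousWithinAt)
      (fun s _ => (hφ s).differentiableAt.differentiableWithinAt) fun s hs => ?_
    rw [interior_Ici] at hs
    rw [(hφ s).deriv]
    exact hφ' s hs.le
  exact h0 ▸ hanti Set.self_mem_Ici ht ht

lemma inner_apply_sub_le_of_lipschitz {E : Type*} [NormedAddCommGroup E] [InnerProductSpace ℝ E]
    {H : E → E →L[ℝ] E} {L : ℝ} (hLip : ∀ y₁ y₂, ‖H y₁ - H y₂‖ ≤ L * ‖y₁ - y₂‖) (y₁ y₂ d : E) :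
    ⟪H y₁ d, d⟫_ℝ - ⟪H y₂ d, d⟫_ℝ ≤ L * ‖y₁ - y₂‖ * ‖d‖ ^ 2 := by
  rw [← inner_sub_left, ← sub_apply]
  calc ⟪(H y₁ - H y₂) d, d⟫_ℝ ≤ ‖(H y₁ - H y₂) d‖ * ‖d‖ := real_inner_le_norm _ _
    _ ≤ (‖H y₁ - H y₂‖ * ‖d‖) * ‖d‖ := by gcongr; exact ContinuousLinearMap.le_opNorm _ _
    _ ≤ ((L * ‖y₁ - y₂‖) * ‖d‖) * ‖d‖ := by gcongr; exact hLip _ _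
    _ = L * ‖y₁ - y₂‖ * ‖d‖ ^ 2 := by ring

/-- The cubic upper Taylor bound for a function with Lipschitz Hessian. -/
lemma le_taylor_cubic_of_lipschitz_hessian
    {E : Type*} [NormedAddCommGroup E] [InnerProductSpace ℝ E] [CompleteSpace E]
    {f : E → ℝ} {g : E → E} {H : E → E →L[ℝ] E} {L : ℝ}
    (hg : ∀ y, HasGradientAt f (g y) y) (hH : ∀ y, HasFDerivAt g (H y) y)
    (hLip : ∀ y₁ y₂, ‖H y₁ - H y₂‖ ≤ L * ‖y₁ - y₂‖) (x d : E) :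
    f (x + d) ≤ f x + ⟪g x, d⟫_ℝ + ⟪H x d, d⟫_ℝ / 2 + L / 6 * ‖d‖ ^ 3 := by
  have hline (t : ℝ) : HasDerivAt (fun t : ℝ => x + t • d) d t := by
    simpa using ((hasDerivAt_id t).smul_const d).const_add x
  have hfline (t : ℝ) : HasDerivAt (fun t : ℝ => f (x + t • d)) ⟪g (x + t • d), d⟫_ℝ t := by
    simpa [Function.comp_def] using (hg (x + t • d)).hasFDerivAt.comp_hasDerivAt t (hline t)
  have hgline (t : ℝ) :
      HasDerivAt (fun t : ℝ => ⟪g (x + t • d), d⟫_ℝ) ⟪H (x + t • d) d, d⟫_ℝ t := by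
    simpa using ((hH (x + t • d)).comp_hasDerivAt t (hline t)).inner ℝ (hasDerivAt_const t d)
  have hgrad (t : ℝ) (ht : 0 ≤ t) :
      ⟪g (x + t • d), d⟫_ℝ
        - (⟪g x, d⟫_ℝ + t * ⟪H x d, d⟫_ℝ + t ^ 2 * (L / 2 * ‖d‖ ^ 3)) ≤ 0 := by
    refine nonpos_of_hasDerivAt_nonpos
      (φ := fun t => ⟪g (x + t • d), d⟫_ℝ
        - (⟪g x, d⟫_ℝ + t * ⟪H x d, d⟫_ℝ + t ^ 2 * (L / 2 * ‖d‖ ^ 3)))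
      (φ' := fun t => ⟪H (x + t • d) d, d⟫_ℝ
        - (⟪H x d, d⟫_ℝ + 2 * t * (L / 2 * ‖d‖ ^ 3))) (by simp) (fun s => ?_) (fun s hs => ?_) ht
    · refine (hgline s).sub (HasDerivAt.add ?_ ?_)
      · simpa using ((hasDerivAt_id s).mul_const ⟪H x d, d⟫_ℝ).const_add ⟪g x, d⟫_ℝ
      · simpa using (hasDerivAt_pow 2 s).mul_const (L / 2 * ‖d‖ ^ 3)
    · have h := inner_apply_sub_le_of_lipschitz hLip (x + s • d) x d
      rw [add_sub_cancel_left, norm_smul, Real.norm_of_nonneg hs] at h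
      linarith
  have hval := nonpos_of_hasDerivAt_nonpos
    (φ := fun t => f (x + t • d)
      - (f x + t * ⟪g x, d⟫_ℝ + t ^ 2 * (⟪H x d, d⟫_ℝ / 2) + t ^ 3 * (L / 6 * ‖d‖ ^ 3)))
    (φ' := fun t => ⟪g (x + t • d), d⟫_ℝ
      - (⟪g x, d⟫_ℝ + 2 * t * (⟪H x d, d⟫_ℝ / 2) + 3 * t ^ 2 * (L / 6 * ‖d‖ ^ 3)))
    (by simp) (fun s => ?_) (fun s hs => by linarith [hgrad s hs]) zero_le_one
  · simp only [one_smul, one_pow, one_mul] at hval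
    linarith
  · refine (hfline s).sub (HasDerivAt.add (HasDerivAt.add ?_ ?_) ?_)
    · simpa using ((hasDerivAt_id s).mul_const ⟪g x, d⟫_ℝ).const_add (f x)
    · simpa using (hasDerivAt_pow 2 s).mul_const (⟪H x d, d⟫_ℝ / 2)
    · simpa using (hasDerivAt_pow 3 s).mul_const (L / 6 * ‖d‖ ^ 3)

lemma mul_sq_le_cube_add_cube {L M r s : ℝ} (hL : 0 ≤ L) (hM : 0 < M) (hr : 0 ≤ r) (hs : 0 ≤ s) :
    L / 2 * s * r ^ 2 ≤ M / 24 * r ^ 3 + 32 * L ^ 3 / (3 * M ^ 2) * s ^ 3 := by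
  have h : 0 ≤ M / 24 * ((r - 8 * (L * s / M)) ^ 2 * (r + 4 * (L * s / M))) := by positivity
  have e : M / 24 * ((r - 8 * (L * s / M)) ^ 2 * (r + 4 * (L * s / M)))
      = M / 24 * r ^ 3 + 32 * L ^ 3 / (3 * M ^ 2) * s ^ 3 - L / 2 * s * r ^ 2 := by
    field_simp
    ring
  linarith

theorem lazy_cubic_func_progress
    {E : Type*} [NormedAddCommGroup E] [InnerProductSpace ℝ E] [FiniteDimensional ℝ E]
    (f : E → ℝ) (g : E → E) (H : E → E →L[ℝ] E) (L : ℝ)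
    (hL : 0 < L) (hf : ContDiff ℝ 2 f)
    (hg : ∀ y, HasGradientAt f (g y) y)
    (hH : ∀ y, HasFDerivAt g (H y) y)
    (hsym : ∀ y u v, ⟪H y u, v⟫_ℝ = ⟪u, H y v⟫_ℝ)
    (hLip : ∀ y₁ y₂, ‖H y₁ - H y₂‖ ≤ L * ‖y₁ - y₂‖)
    (x z T : E) (M r : ℝ) (hr : r = ‖T - x‖)
    (hstat : g x + H z (T - x) + (M * r / 2) • (T - x) = 0)
    (hpsd : ∀ h : E, 0 ≤ ⟪H z h, h⟫_ℝ + M * r / 2 * ‖h‖ ^ 2)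
    (hM : 0 < M) :
    f x - f T ≥ (5 * M - 4 * L) / 24 * r ^ 3 - 32 * L ^ 3 / (3 * M ^ 2) * ‖z - x‖ ^ 3 := by
  have hT := le_taylor_cubic_of_lipschitz_hessian hg hH hLip x (T - x)
  have hxz := inner_apply_sub_le_of_lipschitz hLip x z (T - x)
  have hcurv := hpsd (T - x)
  have hin : ⟪g x, T - x⟫_ℝ + ⟪H z (T - x), T - x⟫_ℝ + M * r / 2 * r ^ 2 = 0 := by
    have h := congrArg (fun v => ⟪v, T - x⟫_ℝ) hstat
    simpa [inner_add_left, real_inner_smul_left, ← hr] using h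
  have hr0 : 0 ≤ r := hr ▸ norm_nonneg _
  have hyoung := mul_sq_le_cube_add_cube hL.le hM hr0 (norm_nonneg (z - x))
  rw [add_sub_cancel, ← hr] at hT
  rw [← hr, norm_sub_rev] at hxz
  rw [← hr] at hcurv
  linarith
end

section
/- Let x, z ∈ E, M > 0, and let T be a lazy cubic Newton step T_M(x, z) with r := ‖T − x‖. Then the Hessian at the new point satisfies, for all h ∈ E: ⟨∇²f(T) h, h⟩ ≥ −( ((M + 2L)/2)·r + L·‖z − x‖ )·‖h‖². Equivalently, the positive part of minus the smallest eigenvalue of ∇²f(T) is at most ((M + 2L)/2)·r + L·‖z − x‖. -/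
open scoped InnerProductSpace

theorem lazy_cubic_hess_bound
    {E : Type*} [NormedAddCommGroup E] [InnerProductSpace ℝ E] [FiniteDimensional ℝ E]
    (f : E → ℝ) (g : E → E) (H : E → E →L[ℝ] E) (L : ℝ)
    (hL : 0 < L) (hf : ContDiff ℝ 2 f)
    (hg : ∀ y, HasGradientAt f (g y) y)
    (hH : ∀ y, HasFDerivAt g (H y) y)
    (hsym : ∀ y u v, ⟪H y u, v⟫_ℝ = ⟪u, H y v⟫_ℝ)
    (hLip : ∀ y₁ y₂, ‖H y₁ - H y₂‖ ≤ L * ‖y₁ - y₂‖)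
    (x z T : E) (M r : ℝ) (hr : r = ‖T - x‖)
    (hstat : g x + H z (T - x) + (M * r / 2) • (T - x) = 0)
    (hpsd : ∀ h : E, 0 ≤ ⟪H z h, h⟫_ℝ + M * r / 2 * ‖h‖ ^ 2)
    (hM : 0 < M) :
    ∀ h : E, ⟪H T h, h⟫_ℝ ≥ -((M + 2 * L) / 2 * r + L * ‖z - x‖) * ‖h‖ ^ 2 := by
  intro h
  have hdist : ‖z - T‖ ≤ ‖z - x‖ + r := by
    rw [hr, norm_sub_rev T x]
    exact norm_sub_le_norm_sub_add_norm_sub z x T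
  have hop : ‖H z - H T‖ ≤ L * (‖z - x‖ + r) :=
    (hLip z T).trans (mul_le_mul_of_nonneg_left hdist hL.le)
  have hdiff : ⟪H z h, h⟫_ℝ - ⟪H T h, h⟫_ℝ ≤ L * (‖z - x‖ + r) * ‖h‖ ^ 2 :=
    calc ⟪H z h, h⟫_ℝ - ⟪H T h, h⟫_ℝ = ⟪(H z - H T) h, h⟫_ℝ := by
          rw [sub_apply, inner_sub_left]
      _ ≤ ‖(H z - H T) h‖ * ‖h‖ := real_inner_le_norm _ _
      _ ≤ ‖H z - H T‖ * ‖h‖ * ‖h‖ := by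
          gcongr
          exact (H z - H T).le_opNorm h
      _ = ‖H z - H T‖ * ‖h‖ ^ 2 := by ring
      _ ≤ L * (‖z - x‖ + r) * ‖h‖ ^ 2 := by gcongr
  linarith [hpsd h]
end

section
/- Let x, z ∈ E, M ≥ L, and let T be a lazy cubic Newton step T_M(x, z) with r := ‖T − x‖. Then f(x) − f(T) ≥ (1/(72·√(2M)))·‖∇f(T)‖^{3/2} + (M/48)·r³ − (11·L³/M²)·‖z − x‖³. -/
open scoped InnerProductSpace

/-- First-order Taylor bound for a map whose derivative is Lipschitz at `x`. -/
theorem norm_sub_sub_le_of_fderiv_lipschitz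
    {E F : Type*} [NormedAddCommGroup E] [NormedSpace ℝ E]
    [NormedAddCommGroup F] [NormedSpace ℝ F]
    {g : E → F} {H : E → E →L[ℝ] F} {L : ℝ} {x : E}
    (hH : ∀ y, HasFDerivAt g (H y) y)
    (hLip : ∀ y, ‖H y - H x‖ ≤ L * ‖y - x‖) (s : E) :
    ‖g (x + s) - g x - H x s‖ ≤ L / 2 * ‖s‖ ^ 2 := by
  have hline : ∀ t : ℝ, HasDerivAt (fun t : ℝ => x + t • s) s t := fun t => by
    simpa using ((hasDerivAt_id t).smul_const s).const_add x
  have hF : ∀ t : ℝ, HasDerivAt (fun t : ℝ => g (x + t • s) - g x - t • H x s)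
      (H (x + t • s) s - H x s) t := fun t =>
    ((((hH (x + t • s)).comp_hasDerivAt t (hline t)).sub_const (g x)).sub
      ((hasDerivAt_id t).smul_const (H x s))).congr_deriv (by simp)
  have hB : ∀ t : ℝ, HasDerivAt (fun t : ℝ => L / 2 * ‖s‖ ^ 2 * t ^ 2)
      (L * ‖s‖ ^ 2 * t) t := fun t =>
    ((hasDerivAt_pow 2 t).const_mul (L / 2 * ‖s‖ ^ 2)).congr_deriv (by push_cast; ring)
  have key := image_norm_le_of_norm_deriv_right_le_deriv_boundary (a := 0) (b := 1)
    (fun t _ => (hF t).continuousAt.continuousWithinAt)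
    (fun t _ => (hF t).hasDerivWithinAt) (by simp) hB
    (fun t ht => by
      rw [← sub_apply]
      refine (ContinuousLinearMap.le_opNorm _ _).trans ?_
      have h := hLip (x + t • s)
      rw [add_sub_cancel_left, norm_smul, Real.norm_of_nonneg ht.1] at h
      calc ‖H (x + t • s) - H x‖ * ‖s‖ ≤ L * (t * ‖s‖) * ‖s‖ := by gcongr
        _ = L * ‖s‖ ^ 2 * t := by ring)
    (Set.right_mem_Icc.2 zero_le_one)
  simpa using key

/-- Second-order Taylor upper bound for a function whose Hessian is Lipschitz at `x`. -/
theorem le_taylor_add_cube_of_hessian_lipschitz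
    {E : Type*} [NormedAddCommGroup E] [InnerProductSpace ℝ E] [CompleteSpace E]
    {f : E → ℝ} {g : E → E} {H : E → E →L[ℝ] E} {L : ℝ} {x : E}
    (hg : ∀ y, HasGradientAt f (g y) y) (hH : ∀ y, HasFDerivAt g (H y) y)
    (hLip : ∀ y, ‖H y - H x‖ ≤ L * ‖y - x‖) (s : E) :
    f (x + s) ≤ f x + ⟪g x, s⟫_ℝ + 1 / 2 * ⟪H x s, s⟫_ℝ + L / 6 * ‖s‖ ^ 3 := by
  have hline : ∀ t : ℝ, HasDerivAt (fun t : ℝ => x + t • s) s t := fun t => by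
    simpa using ((hasDerivAt_id t).smul_const s).const_add x
  have hφ : ∀ t : ℝ, HasDerivAt (fun t : ℝ => f (x + t • s)) ⟪g (x + t • s), s⟫_ℝ t :=
    fun t => ((hg (x + t • s)).hasFDerivAt.comp_hasDerivAt t (hline t)).congr_deriv (by simp)
  have hψ : ∀ t : ℝ, HasDerivAt
      (fun t : ℝ => t * ⟪g x, s⟫_ℝ + t ^ 2 * (1 / 2 * ⟪H x s, s⟫_ℝ)
        + t ^ 3 * (L / 6 * ‖s‖ ^ 3) - f (x + t • s))
      (⟪g x, s⟫_ℝ + t * ⟪H x s, s⟫_ℝ + t ^ 2 * (L / 2 * ‖s‖ ^ 3) - ⟪g (x + t • s), s⟫_ℝ) t :=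
    fun t =>
      (((((hasDerivAt_id t).mul_const ⟪g x, s⟫_ℝ).add
        ((hasDerivAt_pow 2 t).mul_const (1 / 2 * ⟪H x s, s⟫_ℝ))).add
        ((hasDerivAt_pow 3 t).mul_const (L / 6 * ‖s‖ ^ 3))).sub (hφ t)).congr_deriv
        (by push_cast; ring)
  have hmono := monotone_of_deriv_nonneg (fun t => (hψ t).differentiableAt) fun t => by
    rw [(hψ t).deriv]
    have h := (real_inner_le_norm (g (x + t • s) - g x - H x (t • s)) s).trans
      (mul_le_mul_of_nonneg_right (norm_sub_sub_le_of_fderiv_lipschitz hH hLip (t • s))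
        (norm_nonneg s))
    rw [map_smul, inner_sub_left, inner_sub_left, real_inner_smul_left, norm_smul, mul_pow,
      Real.norm_eq_abs, sq_abs] at h
    linear_combination h
  have h := hmono zero_le_one
  simp at h
  linarith

/-- The operator-norm bound for the quadratic form of a bounded linear map. -/
theorem abs_inner_apply_self_le {E : Type*} [NormedAddCommGroup E] [InnerProductSpace ℝ E]
    (A : E →L[ℝ] E) (s : E) : |⟪A s, s⟫_ℝ| ≤ ‖A‖ * ‖s‖ ^ 2 :=
  (abs_real_inner_le_norm _ _).trans <| by
    rw [sq, ← mul_assoc]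
    gcongr
    exact A.le_opNorm s

theorem rpow_three_halves_div_sqrt_le {M G q : ℝ} (hM : 0 < M) (hG : 0 ≤ G) (hq : 0 ≤ q)
    (h : G ≤ M * q ^ 2) :
    1 / (72 * Real.sqrt (2 * M)) * G ^ ((3 : ℝ) / 2) ≤ M * q ^ 3 / 100 := by
  have hm : 0 < √M := Real.sqrt_pos.2 hM
  have hmm : √M ^ 2 = M := Real.sq_sqrt hM.le
  have hpow : G ^ ((3 : ℝ) / 2) ≤ (√M * q) ^ 3 := by
    calc G ^ ((3 : ℝ) / 2) ≤ ((√M * q) ^ 2) ^ ((3 : ℝ) / 2) := by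
          gcongr
          rwa [mul_pow, hmm]
      _ = (√M * q) ^ 3 := by
          rw [← Real.rpow_natCast, ← Real.rpow_mul (by positivity), ← Real.rpow_natCast]
          norm_num
  have h2 : (1.4 : ℝ) ≤ √2 := Real.le_sqrt_of_sq_le (by norm_num)
  rw [Real.sqrt_mul zero_le_two, one_div_mul_eq_div, div_le_iff₀ (by positivity)]
  refine hpow.trans ?_
  have hs : (√M * q) ^ 3 = M * q ^ 3 * √M := by
    linear_combination √M * q ^ 3 * hmm
  have hp : 0 ≤ M * q ^ 3 * √M := by positivity
  rw [hs]
  nlinarith [mul_le_mul_of_nonneg_left h2 hp]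

theorem cubic_progress_scalar {a r : ℝ} (ha : 0 ≤ a) (hr : 0 ≤ r) :
    (r + a / 2) ^ 3 / 100 + r ^ 3 / 48 - 11 * a ^ 3 ≤ r ^ 3 / 12 - a * r ^ 2 / 2 := by
  nlinarith [mul_nonneg hr (sq_nonneg (r - 6 * a)), mul_nonneg ha (sq_nonneg (r - 6 * a)),
    pow_nonneg ha 3, pow_nonneg hr 3, mul_nonneg (pow_nonneg ha 2) hr,
    mul_nonneg (pow_nonneg hr 2) ha]

theorem lazy_cubic_one_step_progress_grad
    {E : Type*} [NormedAddCommGroup E] [InnerProductSpace ℝ E] [FiniteDimensional ℝ E]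
    (f : E → ℝ) (g : E → E) (H : E → E →L[ℝ] E) (L : ℝ)
    (hL : 0 < L) (hf : ContDiff ℝ 2 f)
    (hg : ∀ y, HasGradientAt f (g y) y)
    (hH : ∀ y, HasFDerivAt g (H y) y)
    (hsym : ∀ y u v, ⟪H y u, v⟫_ℝ = ⟪u, H y v⟫_ℝ)
    (hLip : ∀ y₁ y₂, ‖H y₁ - H y₂‖ ≤ L * ‖y₁ - y₂‖)
    (x z T : E) (M r : ℝ) (hr : r = ‖T - x‖)
    (hstat : g x + H z (T - x) + (M * r / 2) • (T - x) = 0)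
    (hpsd : ∀ h : E, 0 ≤ ⟪H z h, h⟫_ℝ + M * r / 2 * ‖h‖ ^ 2)
    (hM : L ≤ M) :
    f x - f T ≥ 1 / (72 * Real.sqrt (2 * M)) * ‖g T‖ ^ ((3 : ℝ) / 2)
      + M / 48 * r ^ 3 - 11 * L ^ 3 / M ^ 2 * ‖z - x‖ ^ 3 := by
  have hM0 : 0 < M := hL.trans_le hM
  obtain ⟨s, rfl⟩ : ∃ s, T = x + s := ⟨T - x, by abel⟩
  rw [add_sub_cancel_left] at hr hstat
  have hr0 : 0 ≤ r := hr ▸ norm_nonneg s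
  obtain ⟨a, ha⟩ : ∃ a, a = L * ‖z - x‖ / M := ⟨_, rfl⟩
  have ha0 : 0 ≤ a := by rw [ha]; positivity
  have hMa : L * ‖z - x‖ = M * a := by rw [ha]; field_simp
  have hHzx : ‖H z - H x‖ ≤ M * a := hMa ▸ hLip z x
  have hgrad : ‖g (x + s)‖ ≤ M * (r + a / 2) ^ 2 := by
    have heq : g (x + s) = (g (x + s) - g x - H x s) - (H z - H x) s - (M * r / 2) • s := by
      rw [sub_apply, ← sub_eq_zero, ← hstat]
      abel
    have h1 := norm_sub_sub_le_of_fderiv_lipschitz hH (fun y => hLip y x) s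
    have h2 := (H z - H x).le_of_opNorm_le hHzx s
    have h3 : ‖(M * r / 2) • s‖ = M * r / 2 * r := by
      rw [norm_smul, Real.norm_of_nonneg (by positivity), ← hr]
    rw [← hr] at h1 h2
    have h4 : ‖g (x + s)‖ ≤ L / 2 * r ^ 2 + M * a * r + M * r / 2 * r := by
      rw [heq]
      exact (norm_sub_le _ _).trans (add_le_add ((norm_sub_le _ _).trans (add_le_add h1 h2)) h3.le)
    nlinarith [mul_le_mul_of_nonneg_right hM (sq_nonneg r), mul_nonneg hM0.le (sq_nonneg a)]
  have hdec : M * (r ^ 3 / 12 - a * r ^ 2 / 2) ≤ f x - f (x + s) := by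
    have h1 := le_taylor_add_cube_of_hessian_lipschitz hg hH (fun y => hLip y x) s
    have h2 := congrArg (fun v => ⟪v, s⟫_ℝ) hstat
    simp only [inner_add_left, real_inner_smul_left, real_inner_self_eq_norm_sq,
      inner_zero_left] at h2
    have h3 := (neg_le_of_abs_le (abs_inner_apply_self_le (H z - H x) s))
    rw [sub_apply, inner_sub_left] at h3
    have h4 := hpsd s
    rw [← hr] at h1 h2 h3 h4
    have h5 := mul_le_mul_of_nonneg_right hHzx (sq_nonneg r)
    have h6 := mul_le_mul_of_nonneg_right hM (pow_nonneg hr0 3)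
    linarith
  have hG := rpow_three_halves_div_sqrt_le hM0 (norm_nonneg (g (x + s)))
    (by positivity : 0 ≤ r + a / 2) hgrad
  have hS := mul_le_mul_of_nonneg_left (cubic_progress_scalar ha0 hr0) hM0.le
  have hZ : 11 * L ^ 3 / M ^ 2 * ‖z - x‖ ^ 3 = 11 * M * a ^ 3 := by
    rw [ha]
    field_simp
  rw [hZ]
  linarith
end

section
/- Let x, z ∈ E, M ≥ L, and let T be a lazy cubic Newton step T_M(x, z) with r := ‖T − x‖. Then for every ξ ≥ 0 such that there exists a unit vector h ∈ E with ⟨∇²f(T) h, h⟩ ≤ −ξ, one has f(x) − f(T) ≥ ξ³/(648·M²) + (M/48)·r³ − (11·L³/M²)·‖z − x‖³. -/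
open scoped InnerProductSpace

lemma le_of_hasDerivAt_nonneg {F F' : ℝ → ℝ} (hF : ∀ t, HasDerivAt F (F' t) t)
    (hF' : ∀ t, 0 ≤ t → 0 ≤ F' t) {t : ℝ} (ht : 0 ≤ t) : F 0 ≤ F t := by
  have hmono : MonotoneOn F (Set.Ici 0) := by
    refine monotoneOn_of_deriv_nonneg (convex_Ici 0)
      (fun s _ => (hF s).continuousAt.continuousWithinAt)
      (fun s _ => (hF s).differentiableAt.differentiableWithinAt) fun s hs => ?_
    rw [(hF s).deriv]
    rw [interior_Ici] at hs
    exact hF' s hs.le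
  exact hmono Set.self_mem_Ici ht ht

lemma abs_inner_apply_self_sub_le {E : Type*} [NormedAddCommGroup E] [InnerProductSpace ℝ E]
    {H : E → E →L[ℝ] E} {L : ℝ} (hLip : ∀ y₁ y₂, ‖H y₁ - H y₂‖ ≤ L * ‖y₁ - y₂‖) (a b u : E) :
    |⟪H a u, u⟫_ℝ - ⟪H b u, u⟫_ℝ| ≤ L * ‖a - b‖ * ‖u‖ ^ 2 := by
  calc |⟪H a u, u⟫_ℝ - ⟪H b u, u⟫_ℝ| = |⟪(H a - H b) u, u⟫_ℝ| := by
        rw [sub_apply, inner_sub_left]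
    _ ≤ ‖(H a - H b) u‖ * ‖u‖ := abs_real_inner_le_norm _ _
    _ ≤ ‖H a - H b‖ * ‖u‖ * ‖u‖ := by gcongr; exact ContinuousLinearMap.le_opNorm _ _
    _ ≤ L * ‖a - b‖ * ‖u‖ * ‖u‖ := by gcongr; exact hLip a b
    _ = L * ‖a - b‖ * ‖u‖ ^ 2 := by ring

/-- The cubic upper model of a function with Lipschitz Hessian. -/
lemma le_cubic_model_of_lipschitz_hessian
    {E : Type*} [NormedAddCommGroup E] [InnerProductSpace ℝ E] [CompleteSpace E]
    {f : E → ℝ} {g : E → E} {H : E → E →L[ℝ] E} {L : ℝ}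
    (hg : ∀ y, HasGradientAt f (g y) y) (hH : ∀ y, HasFDerivAt g (H y) y)
    (hLip : ∀ y₁ y₂, ‖H y₁ - H y₂‖ ≤ L * ‖y₁ - y₂‖) (x p : E) :
    f (x + p) ≤ f x + ⟪g x, p⟫_ℝ + ⟪H x p, p⟫_ℝ / 2 + L / 6 * ‖p‖ ^ 3 := by
  have hline (t : ℝ) : HasDerivAt (fun s : ℝ => x + s • p) p t := by
    simpa using ((hasDerivAt_id t).smul_const p).const_add x
  have hf' (t : ℝ) : HasDerivAt (fun s : ℝ => f (x + s • p)) ⟪g (x + t • p), p⟫_ℝ t := by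
    simpa [Function.comp_def] using (hg (x + t • p)).hasFDerivAt.comp_hasDerivAt t (hline t)
  have hg' (t : ℝ) : HasDerivAt (fun s : ℝ => ⟪g (x + s • p), p⟫_ℝ)
      ⟪H (x + t • p) p, p⟫_ℝ t := by
    simpa using ((hH (x + t • p)).comp_hasDerivAt t (hline t)).inner ℝ (hasDerivAt_const t p)
  have hgrad (t : ℝ) (ht : 0 ≤ t) :
      0 ≤ ⟪g x, p⟫_ℝ + t * ⟪H x p, p⟫_ℝ + L / 2 * ‖p‖ ^ 3 * t ^ 2 - ⟪g (x + t • p), p⟫_ℝ := by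
    have hder (s : ℝ) : HasDerivAt
        (fun s => ⟪g x, p⟫_ℝ + s * ⟪H x p, p⟫_ℝ + L / 2 * ‖p‖ ^ 3 * s ^ 2 - ⟪g (x + s • p), p⟫_ℝ)
        (⟪H x p, p⟫_ℝ + L * ‖p‖ ^ 3 * s - ⟪H (x + s • p) p, p⟫_ℝ) s := by
      refine HasDerivAt.congr_deriv (((((hasDerivAt_id s).mul_const ⟪H x p, p⟫_ℝ).const_add ⟪g x, p⟫_ℝ).add
        ((hasDerivAt_pow 2 s).const_mul (L / 2 * ‖p‖ ^ 3))).sub (hg' s)) ?_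
      simp only [Nat.cast_ofNat]
      ring
    have h := le_of_hasDerivAt_nonneg hder (fun s hs => ?_) ht
    · simpa using h
    · have h := (abs_le.mp (abs_inner_apply_self_sub_le hLip (x + s • p) x p)).2
      rw [add_sub_cancel_left, norm_smul, Real.norm_of_nonneg hs] at h
      linarith
  have hder (s : ℝ) : HasDerivAt
      (fun s => s * ⟪g x, p⟫_ℝ + ⟪H x p, p⟫_ℝ / 2 * s ^ 2 + L / 6 * ‖p‖ ^ 3 * s ^ 3
        - f (x + s • p))
      (⟪g x, p⟫_ℝ + s * ⟪H x p, p⟫_ℝ + L / 2 * ‖p‖ ^ 3 * s ^ 2 - ⟪g (x + s • p), p⟫_ℝ) s := by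
    refine HasDerivAt.congr_deriv (((((hasDerivAt_id s).mul_const ⟪g x, p⟫_ℝ).add
      ((hasDerivAt_pow 2 s).const_mul (⟪H x p, p⟫_ℝ / 2))).add
      ((hasDerivAt_pow 3 s).const_mul (L / 6 * ‖p‖ ^ 3))).sub (hf' s)) ?_
    simp only [Nat.cast_ofNat]
    ring
  have h := le_of_hasDerivAt_nonneg hder hgrad zero_le_one
  simp only [zero_smul, one_smul, add_zero, zero_mul, one_mul, one_pow, mul_one] at h
  norm_num at h
  linarith

lemma lazy_cubic_scalar_bound {M r a ξ : ℝ} (hM : 0 < M) (hr : 0 ≤ r) (ha : 0 ≤ a) (hξ : 0 ≤ ξ)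
    (h : ξ ≤ M * (3 / 2 * r + a)) :
    ξ ^ 3 / (648 * M ^ 2) + M / 48 * r ^ 3 - 11 * M * a ^ 3
      ≤ M * (r ^ 3 / 12 - a * r ^ 2 / 2) := by
  have hcube : ξ ^ 3 / (648 * M ^ 2) ≤ M * ((3 / 2 * r + a) ^ 3 / 648) := by
    calc ξ ^ 3 / (648 * M ^ 2) ≤ (M * (3 / 2 * r + a)) ^ 3 / (648 * M ^ 2) := by gcongr
      _ = M * ((3 / 2 * r + a) ^ 3 / 648) := by field_simp
  have hsplit : (3 / 2 * r + a) ^ 3 ≤ 4 * ((3 / 2 * r) ^ 3 + a ^ 3) := by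
    have : 0 ≤ (3 / 2 * r + a) * (3 / 2 * r - a) ^ 2 := by positivity
    linarith
  have hmin : 0 ≤ (r - 8 * a) ^ 2 * (r + 4 * a) := by positivity
  have ha3 : 0 ≤ a ^ 3 := by positivity
  have hscalar : (3 / 2 * r + a) ^ 3 / 648 + r ^ 3 / 48 - 11 * a ^ 3
      ≤ r ^ 3 / 12 - a * r ^ 2 / 2 := by
    linarith
  have := mul_le_mul_of_nonneg_left hscalar hM.le
  linarith

theorem lazy_cubic_one_step_progress_eig
    {E : Type*} [NormedAddCommGroup E] [InnerProductSpace ℝ E] [FiniteDimensional ℝ E]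
    (f : E → ℝ) (g : E → E) (H : E → E →L[ℝ] E) (L : ℝ)
    (hL : 0 < L) (hf : ContDiff ℝ 2 f)
    (hg : ∀ y, HasGradientAt f (g y) y)
    (hH : ∀ y, HasFDerivAt g (H y) y)
    (hsym : ∀ y u v, ⟪H y u, v⟫_ℝ = ⟪u, H y v⟫_ℝ)
    (hLip : ∀ y₁ y₂, ‖H y₁ - H y₂‖ ≤ L * ‖y₁ - y₂‖)
    (x z T : E) (M r : ℝ) (hr : r = ‖T - x‖)
    (hstat : g x + H z (T - x) + (M * r / 2) • (T - x) = 0)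
    (hpsd : ∀ h : E, 0 ≤ ⟪H z h, h⟫_ℝ + M * r / 2 * ‖h‖ ^ 2)
    (hM : L ≤ M)
    (ξ : ℝ) (hξ : 0 ≤ ξ)
    (hvec : ∃ h : E, ‖h‖ = 1 ∧ ⟪H T h, h⟫_ℝ ≤ -ξ) :
    f x - f T ≥ ξ ^ 3 / (648 * M ^ 2) + M / 48 * r ^ 3 - 11 * L ^ 3 / M ^ 2 * ‖z - x‖ ^ 3 := by
  have hM0 : 0 < M := hL.trans_le hM
  have hr0 : 0 ≤ r := hr ▸ norm_nonneg _
  have hξ' : ξ ≤ M * (3 / 2 * r + L * ‖z - x‖ / M) := by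
    obtain ⟨h, hh, hneg⟩ := hvec
    have hdiff := (abs_le.mp (abs_inner_apply_self_sub_le hLip T z h)).1
    have hcurv := hpsd h
    have htri : ‖T - z‖ ≤ r + ‖z - x‖ := by
      rw [hr, norm_sub_rev z x]
      exact norm_sub_le_norm_sub_add_norm_sub T x z
    have hLtri := mul_le_mul_of_nonneg_left htri hL.le
    have hLr := mul_le_mul_of_nonneg_right hM hr0
    rw [hh] at hdiff hcurv
    rw [mul_add, mul_div_cancel₀ _ hM0.ne']
    linarith
  have hprog : M * (r ^ 3 / 12 - L * ‖z - x‖ / M * r ^ 2 / 2) ≤ f x - f T := by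
    have hmodel := le_cubic_model_of_lipschitz_hessian hg hH hLip x (T - x)
    have hdiff := (abs_le.mp (abs_inner_apply_self_sub_le hLip x z (T - x))).2
    have hcurv := hpsd (T - x)
    have hinner := congrArg (fun v => ⟪v, T - x⟫_ℝ) hstat
    simp only [inner_add_left, real_inner_smul_left, real_inner_self_eq_norm_sq,
      inner_zero_left] at hinner
    rw [add_sub_cancel] at hmodel
    rw [norm_sub_rev x z] at hdiff
    rw [← hr] at hmodel hdiff hcurv hinner
    have hLr := mul_le_mul_of_nonneg_right hM (pow_nonneg hr0 3)
    have hcancel : M * (L * ‖z - x‖ / M * r ^ 2 / 2) = L * ‖z - x‖ * r ^ 2 / 2 := by field_simp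
    rw [mul_sub, hcancel]
    linarith
  have hbound := lazy_cubic_scalar_bound hM0 hr0
    (div_nonneg (mul_nonneg hL.le (norm_nonneg (z - x))) hM0.le) hξ hξ'
  have hcube : 11 * M * (L * ‖z - x‖ / M) ^ 3 = 11 * L ^ 3 / M ^ 2 * ‖z - x‖ ^ 3 := by field_simp
  rw [hcube] at hbound
  exact hbound.trans hprog
end

section
/- Let m ≥ 1, M ≥ 6·m·L, and let x_0, x_1, …, x_m ∈ E be such that for each 0 ≤ k ≤ m−1 the point x_{k+1} is a lazy cubic Newton step T_M(x_k, x_0) (Hessian snapshot taken at x_0). Then f(x_0) − f(x_m) ≥ (1/(72·√(2M))) · ∑_{k=1}^{m} ‖∇f(x_k)‖^{3/2}. -/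
open scoped InnerProductSpace

section LipschitzHessian

variable {E : Type*} [NormedAddCommGroup E] [InnerProductSpace ℝ E]

/-- First-order Taylor estimate for a gradient with Lipschitz derivative. -/
theorem norm_sub_sub_fderiv_le_of_lipschitz {g : E → E} {H : E → E →L[ℝ] E} {L : ℝ}
    (hL : 0 ≤ L) (hH : ∀ y, HasFDerivAt g (H y) y)
    (hLip : ∀ y₁ y₂, ‖H y₁ - H y₂‖ ≤ L * ‖y₁ - y₂‖) (y s : E) :
    ‖g (y + s) - g y - H y s‖ ≤ L * ‖s‖ ^ 2 := by
  have key := (convex_closedBall y ‖s‖).norm_image_sub_le_of_norm_hasFDerivWithin_le'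
    (f := g) (f' := H) (φ := H y) (C := L * ‖s‖) (x := y) (y := y + s)
    (fun z _ => (hH z).hasFDerivWithinAt)
    (fun z hz => (hLip z y).trans (by
      rw [mem_closedBall_iff_norm] at hz
      gcongr))
    (by simp) (by simp)
  simpa [pow_two, mul_assoc] using key

/-- Second-order Taylor upper bound for a function with Lipschitz Hessian. -/
theorem le_quadratic_model_add_of_lipschitz [CompleteSpace E] {f : E → ℝ} {g : E → E}
    {H : E → E →L[ℝ] E} {L : ℝ} (hL : 0 ≤ L) (hg : ∀ y, HasGradientAt f (g y) y)
    (hH : ∀ y, HasFDerivAt g (H y) y)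
    (hLip : ∀ y₁ y₂, ‖H y₁ - H y₂‖ ≤ L * ‖y₁ - y₂‖) (y s : E) :
    f (y + s) ≤ f y + ⟪g y, s⟫_ℝ + ⟪H y s, s⟫_ℝ / 2 + L / 3 * ‖s‖ ^ 3 := by
  have hd : ∀ t : ℝ, HasDerivAt
      (fun t : ℝ => f (y + t • s) - t * ⟪g y, s⟫_ℝ - t ^ 2 * (⟪H y s, s⟫_ℝ / 2)
        - t ^ 3 * (L / 3 * ‖s‖ ^ 3))
      (⟪g (y + t • s) - g y - H y (t • s), s⟫_ℝ - L * ‖t • s‖ ^ 2 * ‖s‖) t := by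
    intro t
    have hline : HasDerivAt (fun t : ℝ => y + t • s) s t := by
      simpa using ((hasDerivAt_id t).smul_const s).const_add y
    have h1 : HasDerivAt (fun t : ℝ => f (y + t • s)) ⟪g (y + t • s), s⟫_ℝ t := by
      simpa [Function.comp_def] using
        (hg (y + t • s)).hasFDerivAt.comp_hasDerivAt t hline
    have h2 := ((h1.sub ((hasDerivAt_id t).mul_const ⟪g y, s⟫_ℝ)).sub
      ((hasDerivAt_pow 2 t).mul_const (⟪H y s, s⟫_ℝ / 2))).sub
      ((hasDerivAt_pow 3 t).mul_const (L / 3 * ‖s‖ ^ 3))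
    refine h2.congr_deriv ?_
    simp only [map_smul, inner_sub_left, real_inner_smul_left, norm_smul, mul_pow,
      Real.norm_eq_abs, sq_abs]
    norm_num
    ring
  have hanti := antitone_of_hasDerivAt_nonpos hd fun t => by
    have h1 := real_inner_le_norm (g (y + t • s) - g y - H y (t • s)) s
    have h2 := norm_sub_sub_fderiv_le_of_lipschitz hL hH hLip y (t • s)
    have h3 := mul_le_mul_of_nonneg_right h2 (norm_nonneg s)
    simp only [Pi.zero_apply]
    linarith
  have h01 := hanti (zero_le_one' ℝ)
  simp only [one_smul, zero_smul, add_zero] at h01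
  norm_num at h01
  linarith

/-- Function decrease of one lazy cubic Newton step `s` from `y` with snapshot `z`. -/
theorem lazy_cubic_step_decrease [CompleteSpace E] {f : E → ℝ} {g : E → E}
    {H : E → E →L[ℝ] E} {L M : ℝ} (hL : 0 ≤ L) (hg : ∀ y, HasGradientAt f (g y) y)
    (hH : ∀ y, HasFDerivAt g (H y) y)
    (hLip : ∀ y₁ y₂, ‖H y₁ - H y₂‖ ≤ L * ‖y₁ - y₂‖) {y z s : E}
    (hstep : g y + H z s + (M * ‖s‖ / 2) • s = 0)
    (hpsd : 0 ≤ ⟪H z s, s⟫_ℝ + M * ‖s‖ / 2 * ‖s‖ ^ 2) :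
    M / 4 * ‖s‖ ^ 3 - L / 2 * ‖y - z‖ * ‖s‖ ^ 2 - L / 3 * ‖s‖ ^ 3 ≤ f y - f (y + s) := by
  have htaylor := le_quadratic_model_add_of_lipschitz hL hg hH hLip y s
  have hinner : ⟪g y, s⟫_ℝ + ⟪H z s, s⟫_ℝ + M * ‖s‖ / 2 * ‖s‖ ^ 2 = 0 := by
    have h := congrArg (fun v => ⟪v, s⟫_ℝ) hstep
    simpa only [inner_add_left, real_inner_smul_left, real_inner_self_eq_norm_sq,
      inner_zero_left] using h
  have hdiff : ⟪H y s, s⟫_ℝ - ⟪H z s, s⟫_ℝ ≤ L * ‖y - z‖ * ‖s‖ ^ 2 := by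
    calc ⟪H y s, s⟫_ℝ - ⟪H z s, s⟫_ℝ = ⟪(H y - H z) s, s⟫_ℝ := by
          simp [inner_sub_left]
      _ ≤ ‖(H y - H z) s‖ * ‖s‖ := real_inner_le_norm _ _
      _ ≤ (L * ‖y - z‖ * ‖s‖) * ‖s‖ := by
          gcongr
          exact (H y - H z).le_of_opNorm_le (hLip y z) s
      _ = L * ‖y - z‖ * ‖s‖ ^ 2 := by ring
  nlinarith

/-- Gradient bound after one lazy cubic Newton step `s` from `y` with snapshot `z`. -/
theorem lazy_cubic_step_norm_gradient_le {g : E → E} {H : E → E →L[ℝ] E} {L M : ℝ}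
    (hL : 0 ≤ L) (hM : 0 ≤ M) (hH : ∀ y, HasFDerivAt g (H y) y)
    (hLip : ∀ y₁ y₂, ‖H y₁ - H y₂‖ ≤ L * ‖y₁ - y₂‖) {y z s : E}
    (hstep : g y + H z s + (M * ‖s‖ / 2) • s = 0) :
    ‖g (y + s)‖ ≤ (L + M / 2) * ‖s‖ ^ 2 + L * ‖y - z‖ * ‖s‖ := by
  have hsplit : g (y + s) =
      (g (y + s) - g y - H y s) + (H y - H z) s - (M * ‖s‖ / 2) • s := by
    rw [← sub_eq_zero, ← hstep, sub_apply]
    abel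
  have h1 := norm_sub_sub_fderiv_le_of_lipschitz hL hH hLip y s
  have h2 := (H y - H z).le_of_opNorm_le (hLip y z) s
  have h3 : ‖(M * ‖s‖ / 2) • s‖ = M * ‖s‖ / 2 * ‖s‖ := by
    rw [norm_smul, Real.norm_of_nonneg (by positivity)]
  rw [hsplit]
  refine (norm_sub_le _ _).trans ?_
  have h4 := norm_add_le (g (y + s) - g y - H y s) ((H y - H z) s)
  nlinarith

end LipschitzHessian

theorem rpow_three_halves_le_of_le_mul_sq_max {a M r e : ℝ} (ha : 0 ≤ a) (hM : 0 ≤ M)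
    (hr : 0 ≤ r) (he : 0 ≤ e) (h : a ≤ M * max r e ^ 2) :
    a ^ ((3 : ℝ) / 2) ≤ Real.sqrt M * M * (r ^ 3 + e ^ 3) := by
  have hpow : ∀ b : ℝ, 0 ≤ b → b ^ ((3 : ℝ) / 2) = Real.sqrt b ^ 3 := fun b hb => by
    rw [Real.sqrt_eq_rpow, ← Real.rpow_natCast, ← Real.rpow_mul hb]
    norm_num
  have hmax : 0 ≤ max r e := le_max_of_le_left hr
  have hcube : max r e ^ 3 ≤ r ^ 3 + e ^ 3 := by
    rcases max_choice r e with h | h <;> rw [h]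
    · linarith [pow_nonneg he 3]
    · linarith [pow_nonneg hr 3]
  calc a ^ ((3 : ℝ) / 2) ≤ (M * max r e ^ 2) ^ ((3 : ℝ) / 2) := by gcongr
    _ = Real.sqrt M * Real.sqrt M ^ 2 * max r e ^ 3 := by
        rw [hpow _ (by positivity), Real.sqrt_mul hM, Real.sqrt_sq hmax]
        ring
    _ ≤ Real.sqrt M * M * (r ^ 3 + e ^ 3) := by
        rw [Real.sq_sqrt hM]
        gcongr

theorem lazy_cubic_phase_progress
    {E : Type*} [NormedAddCommGroup E] [InnerProductSpace ℝ E] [FiniteDimensional ℝ E]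
    (f : E → ℝ) (g : E → E) (H : E → E →L[ℝ] E) (L : ℝ)
    (hL : 0 < L) (hf : ContDiff ℝ 2 f)
    (hg : ∀ y, HasGradientAt f (g y) y)
    (hH : ∀ y, HasFDerivAt g (H y) y)
    (hsym : ∀ y u v, ⟪H y u, v⟫_ℝ = ⟪u, H y v⟫_ℝ)
    (hLip : ∀ y₁ y₂, ‖H y₁ - H y₂‖ ≤ L * ‖y₁ - y₂‖)
    (m : ℕ) (hm : 1 ≤ m) (M : ℝ) (x : ℕ → E)
    (hstep : ∀ k < m,
      g (x k) + H (x 0) (x (k + 1) - x k)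
        + (M * ‖x (k + 1) - x k‖ / 2) • (x (k + 1) - x k) = 0)
    (hpsd : ∀ k < m, ∀ h : E,
      0 ≤ ⟪H (x 0) h, h⟫_ℝ + M * ‖x (k + 1) - x k‖ / 2 * ‖h‖ ^ 2)
    (hM : 6 * (m : ℝ) * L ≤ M) :
    f (x 0) - f (x m) ≥
      1 / (72 * Real.sqrt (2 * M)) * ∑ k ∈ Finset.Icc 1 m, ‖g (x k)‖ ^ ((3 : ℝ) / 2) := by
  have hm0 : (0 : ℝ) < m := by exact_mod_cast hm
  have hM0 : 0 < M := lt_of_lt_of_le (by positivity) hM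
  have hLM : 6 * L ≤ M := by
    have h1 : (1 : ℝ) ≤ m := by exact_mod_cast hm
    nlinarith
  set r : ℕ → ℝ := fun k => ‖x (k + 1) - x k‖ with hr
  have hr0 : ∀ k, 0 ≤ r k := fun k => norm_nonneg _
  set S := ∑ k ∈ Finset.range m, r k ^ 3 with hS
  set e := (∑ k ∈ Finset.range m, r k) / m with he
  have he0 : 0 ≤ e := div_nonneg (Finset.sum_nonneg fun k _ => hr0 k) hm0.le
  have heS : m * e ^ 3 ≤ S := by
    have h := pow_sum_div_card_le_sum_pow (s := Finset.range m) (f := r)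
      (fun k _ => hr0 k) 2
    rw [Finset.card_range] at h
    refine le_trans (le_of_eq ?_) h
    rw [he]
    field_simp
  have hdist : ∀ k < m, ‖x k - x 0‖ ≤ m * e := by
    intro k hk
    rw [he, mul_div_cancel₀ _ hm0.ne', ← Finset.sum_range_sub x k]
    exact (norm_sum_le _ _).trans (Finset.sum_le_sum_of_subset_of_nonneg
      (Finset.range_subset_range.2 hk.le) fun i _ _ => hr0 i)
  have hLd : ∀ k < m, L * ‖x k - x 0‖ ≤ M / 6 * e := by
    intro k hk
    nlinarith [mul_le_mul_of_nonneg_left (hdist k hk) hL.le,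
      mul_le_mul_of_nonneg_right hM he0]
  have hdec : ∀ k < m, M / 9 * r k ^ 3 - M / 12 * e ^ 3 ≤ f (x k) - f (x (k + 1)) := by
    intro k hk
    have h := lazy_cubic_step_decrease hL.le hg hH hLip (hstep k hk) (hpsd k hk _)
    rw [add_sub_cancel] at h
    change M / 4 * r k ^ 3 - L / 2 * ‖x k - x 0‖ * r k ^ 2 - L / 3 * r k ^ 3 ≤ _ at h
    have hyoung : e * r k ^ 2 ≤ r k ^ 3 + e ^ 3 := by
      rcases le_total e (r k) with hle | hle
      · nlinarith [pow_nonneg he0 3, mul_le_mul_of_nonneg_right hle (sq_nonneg (r k))]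
      · nlinarith [pow_nonneg (hr0 k) 3,
          mul_le_mul_of_nonneg_left (pow_le_pow_left₀ (hr0 k) hle 2) he0]
    have h1 := mul_le_mul_of_nonneg_right (hLd k hk) (sq_nonneg (r k))
    have h2 := mul_le_mul_of_nonneg_left hyoung hM0.le
    have h3 := mul_le_mul_of_nonneg_right hLM (pow_nonneg (hr0 k) 3)
    linarith
  have hgrad : ∀ k < m,
      ‖g (x (k + 1))‖ ^ ((3 : ℝ) / 2) ≤ Real.sqrt M * M * (r k ^ 3 + e ^ 3) := by
    intro k hk
    refine rpow_three_halves_le_of_le_mul_sq_max (norm_nonneg _) hM0.le (hr0 k) he0 ?_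
    have h := lazy_cubic_step_norm_gradient_le hL.le hM0.le hH hLip (hstep k hk)
    rw [add_sub_cancel] at h
    change _ ≤ (L + M / 2) * r k ^ 2 + L * ‖x k - x 0‖ * r k at h
    have hmax0 : 0 ≤ max (r k) e := le_max_of_le_right he0
    have h1 : r k ^ 2 ≤ max (r k) e ^ 2 := pow_le_pow_left₀ (hr0 k) (le_max_left _ _) 2
    have h2 : e * r k ≤ max (r k) e ^ 2 := by
      rw [pow_two]
      exact mul_le_mul (le_max_right _ _) (le_max_left _ _) (hr0 k) hmax0
    have h3 := mul_le_mul_of_nonneg_right (hLd k hk) (hr0 k)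
    have h4 := mul_le_mul_of_nonneg_left h2 hM0.le
    have h5 := mul_le_mul_of_nonneg_left h1 hM0.le
    have h6 := mul_le_mul_of_nonneg_right hLM (sq_nonneg (r k))
    nlinarith [mul_nonneg hM0.le (sq_nonneg (max (r k) e))]
  have hdecrease : M / 36 * S ≤ f (x 0) - f (x m) := by
    have h := Finset.sum_le_sum fun k hk => hdec k (Finset.mem_range.1 hk)
    rw [Finset.sum_range_sub', Finset.sum_sub_distrib, ← Finset.mul_sum, Finset.sum_const,
      Finset.card_range, nsmul_eq_mul] at h
    nlinarith [mul_le_mul_of_nonneg_left heS hM0.le]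
  have hgrads : ∑ k ∈ Finset.Icc 1 m, ‖g (x k)‖ ^ ((3 : ℝ) / 2) ≤
      Real.sqrt M * M * (2 * S) := by
    have hshift : ∑ k ∈ Finset.Icc 1 m, ‖g (x k)‖ ^ ((3 : ℝ) / 2) =
        ∑ k ∈ Finset.range m, ‖g (x (k + 1))‖ ^ ((3 : ℝ) / 2) := by
      rw [Finset.range_eq_Ico, Finset.sum_Ico_add' (fun k => ‖g (x k)‖ ^ ((3 : ℝ) / 2)) 0 m 1]
      rfl
    rw [hshift]
    refine (Finset.sum_le_sum fun k hk => hgrad k (Finset.mem_range.1 hk)).trans ?_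
    rw [← Finset.mul_sum, Finset.sum_add_distrib, Finset.sum_const, Finset.card_range,
      nsmul_eq_mul]
    gcongr
    linarith
  have hsqrt : Real.sqrt M ≤ Real.sqrt (2 * M) := Real.sqrt_le_sqrt (by linarith)
  have hsqrt0 : 0 < Real.sqrt (2 * M) := Real.sqrt_pos.2 (by positivity)
  rw [ge_iff_le, one_div, inv_mul_le_iff₀ (by positivity)]
  have hS0 : 0 ≤ S := Finset.sum_nonneg fun k _ => pow_nonneg (hr0 k) 3
  calc _ ≤ Real.sqrt M * M * (2 * S) := hgrads
    _ ≤ Real.sqrt (2 * M) * M * (2 * S) := by gcongr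
    _ = 72 * Real.sqrt (2 * M) * (M / 36 * S) := by ring
    _ ≤ 72 * Real.sqrt (2 * M) * (f (x 0) - f (x m)) := by gcongr
end

section
/- Assume f is convex and let M ≥ 3·L. Let x, z ∈ E with ∇f(x) ≠ 0, set λ := √(M·‖∇f(x)‖), and let x⁺ be the regularized lazy Newton step from x with Hessian snapshot z and regularization λ. Then f(x) − f(x⁺) ≥ (9/(244·λ))·‖∇f(x⁺)‖² + (M/8)·‖x⁺ − x‖³ − (3·L³/M²)·‖z − x‖³. -/
open scoped InnerProductSpace

/-- First-order convexity inequality, from monotonicity of the gradient along a segment. -/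
theorem inner_gradient_sub_le_of_hessian_nonneg
    {E : Type*} [NormedAddCommGroup E] [InnerProductSpace ℝ E] [CompleteSpace E]
    {f : E → ℝ} {g : E → E} {H : E → E →L[ℝ] E}
    (hg : ∀ y, HasGradientAt f (g y) y) (hH : ∀ y, HasFDerivAt g (H y) y)
    (hconv : ∀ y h, 0 ≤ ⟪H y h, h⟫_ℝ) (x y : E) :
    ⟪g y, x - y⟫_ℝ ≤ f x - f y := by
  have hline (t : ℝ) : HasDerivAt (fun t : ℝ => y + t • (x - y)) (x - y) t := by
    simpa using ((hasDerivAt_id t).smul_const (x - y)).const_add y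
  have hφ (t : ℝ) : HasDerivAt (fun t : ℝ => f (y + t • (x - y)))
      ⟪g (y + t • (x - y)), x - y⟫_ℝ t := by
    simpa [Function.comp_def] using (hg _).hasFDerivAt.comp_hasDerivAt t (hline t)
  have hφ' (t : ℝ) : HasDerivAt (fun t : ℝ => ⟪g (y + t • (x - y)), x - y⟫_ℝ)
      ⟪H (y + t • (x - y)) (x - y), x - y⟫_ℝ t := by
    simpa using ((hH _).comp_hasDerivAt t (hline t)).inner ℝ (hasDerivAt_const t (x - y))
  have hmono : Monotone fun t : ℝ => ⟪g (y + t • (x - y)), x - y⟫_ℝ :=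
    monotone_of_deriv_nonneg (fun t => (hφ' t).differentiableAt) fun t => by
      rw [(hφ' t).deriv]
      exact hconv _ _
  obtain ⟨c, hc, hslope⟩ := exists_hasDerivAt_eq_slope _ _ zero_lt_one
    (continuous_iff_continuousAt.2 fun t => (hφ t).continuousAt).continuousOn fun t _ => hφ t
  have hle := hmono hc.1.le
  simp only [zero_smul, one_smul, add_zero, add_sub_cancel, sub_zero, div_one] at hle hslope
  linarith

/-- Linearization error of a map at a snapshot `z` of its Lipschitz derivative. -/
theorem norm_sub_sub_le_of_lipschitz_fderiv
    {E F : Type*} [NormedAddCommGroup E] [NormedSpace ℝ E]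
    [NormedAddCommGroup F] [NormedSpace ℝ F]
    {g : E → F} {H : E → E →L[ℝ] F} {L : ℝ} (hL : 0 ≤ L)
    (hH : ∀ y, HasFDerivAt g (H y) y)
    (hLip : ∀ y₁ y₂, ‖H y₁ - H y₂‖ ≤ L * ‖y₁ - y₂‖) (x y z : E) :
    ‖g y - g x - H z (y - x)‖ ≤ L * (‖y - x‖ + ‖z - x‖) * ‖y - x‖ := by
  refine (convex_segment x y).norm_image_sub_le_of_norm_hasFDerivWithin_le'
    (fun w _ => (hH w).hasFDerivWithinAt) (fun w hw => ?_)
    (left_mem_segment ℝ x y) (right_mem_segment ℝ x y)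
  refine (hLip w z).trans (mul_le_mul_of_nonneg_left ?_ hL)
  calc ‖w - z‖ ≤ ‖w - x‖ + ‖x - z‖ := norm_sub_le_norm_sub_add_norm_sub w x z
    _ ≤ ‖y - x‖ + ‖z - x‖ := by
      rw [norm_sub_rev x z]
      gcongr
      simpa [dist_eq_norm] using norm_sub_le_of_mem_segment hw

theorem sq_mul_le_cube_add_cube {r u : ℝ} (hr : 0 ≤ r) (hu : 0 ≤ u) :
    u ^ 2 * r ≤ r ^ 3 / 4 + 3 * u ^ 3 := by
  rcases le_total (2 * u) r with h | h
  · nlinarith [mul_nonneg hr (mul_nonneg (sub_nonneg.2 h) (add_nonneg hr hu)),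
      mul_nonneg hr (mul_nonneg (sub_nonneg.2 h) hu), pow_nonneg hu 3]
  · nlinarith [mul_nonneg (sq_nonneg u) (sub_nonneg.2 h), pow_nonneg hu 3, pow_nonneg hr 3]

/-- The error of the linear model is dominated by the cubic decrease and the snapshot penalty. -/
theorem sq_error_div_le {L M r s lam : ℝ} (hL : 0 ≤ L) (hM : 3 * L ≤ M) (hMpos : 0 < M)
    (hlam : 0 < lam) (hr : 0 ≤ r) (hs : 0 ≤ s) (hrlam : M * r ≤ lam) :
    (L * (r + s) * r) ^ 2 / (2 * lam) + M / 8 * r ^ 3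
      ≤ lam * r ^ 2 / 2 + 3 * L ^ 3 / M ^ 2 * s ^ 3 := by
  have herr : (L * (r + s) * r) ^ 2 / (2 * lam) ≤ M * r ^ 3 / 9 + L ^ 2 * s ^ 2 * r / M := by
    rw [div_le_iff₀ (by positivity)]
    have hLM : L ^ 2 * r ^ 4 ≤ M ^ 2 * r ^ 4 / 9 := by
      nlinarith [mul_nonneg (pow_nonneg hr 4) (by nlinarith : 0 ≤ M ^ 2 - 9 * L ^ 2)]
    calc (L * (r + s) * r) ^ 2
        ≤ 2 * (L ^ 2 * r ^ 4 + L ^ 2 * s ^ 2 * r ^ 2) := by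
          nlinarith [sq_nonneg (L * r * (r - s))]
      _ ≤ (M * r ^ 3 / 9 + L ^ 2 * s ^ 2 * r / M) * (2 * (M * r)) := by
          field_simp
          nlinarith
      _ ≤ (M * r ^ 3 / 9 + L ^ 2 * s ^ 2 * r / M) * (2 * lam) := by gcongr
  have hcubic := mul_le_mul_of_nonneg_left
    (sq_mul_le_cube_add_cube hr (by positivity : 0 ≤ L * s / M)) hMpos.le
  have hleft : M * ((L * s / M) ^ 2 * r) = L ^ 2 * s ^ 2 * r / M := by field_simp
  have hright : M * (r ^ 3 / 4 + 3 * (L * s / M) ^ 3)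
      = M * r ^ 3 / 4 + 3 * L ^ 3 / M ^ 2 * s ^ 3 := by field_simp
  rw [hleft, hright] at hcubic
  have hpos : 0 ≤ M * r ^ 3 := by positivity
  nlinarith [mul_nonneg (sq_nonneg r) (sub_nonneg.2 hrlam)]

theorem grad_reg_newton_one_step_progress
    {E : Type*} [NormedAddCommGroup E] [InnerProductSpace ℝ E] [FiniteDimensional ℝ E]
    (f : E → ℝ) (g : E → E) (H : E → E →L[ℝ] E) (L : ℝ)
    (hL : 0 < L) (hf : ContDiff ℝ 2 f)
    (hg : ∀ y, HasGradientAt f (g y) y)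
    (hH : ∀ y, HasFDerivAt g (H y) y)
    (hsym : ∀ y u v, ⟪H y u, v⟫_ℝ = ⟪u, H y v⟫_ℝ)
    (hLip : ∀ y₁ y₂, ‖H y₁ - H y₂‖ ≤ L * ‖y₁ - y₂‖)
    (hconv : ∀ y h, 0 ≤ ⟪H y h, h⟫_ℝ)
    (x z xp : E) (lam : ℝ)
    (hstep : g x + H z (xp - x) + lam • (xp - x) = 0)
    (M : ℝ) (hM : 3 * L ≤ M) (hgx : g x ≠ 0)
    (hlam : lam = Real.sqrt (M * ‖g x‖)) :
    f x - f xp ≥ 9 / (244 * lam) * ‖g xp‖ ^ 2 + M / 8 * ‖xp - x‖ ^ 3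
      - 3 * L ^ 3 / M ^ 2 * ‖z - x‖ ^ 3 := by
  have hMpos : 0 < M := by linarith
  have hgpos : 0 < ‖g x‖ := norm_pos_iff.2 hgx
  have hlampos : 0 < lam := hlam ▸ Real.sqrt_pos.2 (by positivity)
  have hlamsq : lam ^ 2 = M * ‖g x‖ := by rw [hlam, Real.sq_sqrt (by positivity)]
  have hlength : lam * ‖xp - x‖ ≤ ‖g x‖ := by
    have hinner := congrArg (fun v => ⟪v, xp - x⟫_ℝ) hstep
    simp only [inner_add_left, real_inner_smul_left, real_inner_self_eq_norm_sq,
      inner_zero_left] at hinner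
    have hcs := (abs_le.1 (abs_real_inner_le_norm (g x) (xp - x))).1
    rcases (norm_nonneg (xp - x)).eq_or_lt with h | h
    · simp [← h]
    · refine le_of_mul_le_mul_right ?_ h
      nlinarith [hconv z (xp - x)]
  have hrlam : M * ‖xp - x‖ ≤ lam := by
    refine le_of_mul_le_mul_left ?_ hlampos
    nlinarith
  have herr : ‖g xp + lam • (xp - x)‖ ≤ L * (‖xp - x‖ + ‖z - x‖) * ‖xp - x‖ := by
    have hresidual : g xp - g x - H z (xp - x) = g xp + lam • (xp - x) :=
      calc g xp - g x - H z (xp - x)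
          = g xp + lam • (xp - x) - (g x + H z (xp - x) + lam • (xp - x)) := by abel
        _ = g xp + lam • (xp - x) := by rw [hstep, sub_zero]
    rw [← hresidual]
    exact norm_sub_sub_le_of_lipschitz_fderiv hL.le hH hLip x xp z
  have hsq := pow_le_pow_left₀ (norm_nonneg _) herr 2
  rw [norm_add_sq_real, real_inner_smul_right, norm_smul, Real.norm_of_nonneg hlampos.le] at hsq
  have hdecrease := inner_gradient_sub_le_of_hessian_nonneg hg hH hconv x xp
  rw [← neg_sub xp x, inner_neg_right] at hdecrease
  have hmodel : ‖g xp‖ ^ 2 / (2 * lam) + lam * ‖xp - x‖ ^ 2 / 2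
      - (L * (‖xp - x‖ + ‖z - x‖) * ‖xp - x‖) ^ 2 / (2 * lam) ≤ f x - f xp := by
    refine le_trans ?_ hdecrease
    have hsplit : ‖g xp‖ ^ 2 / (2 * lam) + lam * ‖xp - x‖ ^ 2 / 2
        - (L * (‖xp - x‖ + ‖z - x‖) * ‖xp - x‖) ^ 2 / (2 * lam)
        = (‖g xp‖ ^ 2 + (lam * ‖xp - x‖) ^ 2
          - (L * (‖xp - x‖ + ‖z - x‖) * ‖xp - x‖) ^ 2) / (2 * lam) := by field_simp
    rw [hsplit, div_le_iff₀ (by positivity)]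
    linarith
  have herror := sq_error_div_le hL.le hM hMpos hlampos (norm_nonneg (xp - x))
    (norm_nonneg (z - x)) hrlam
  have hcoeff : 9 / (244 * lam) * ‖g xp‖ ^ 2 ≤ ‖g xp‖ ^ 2 / (2 * lam) := by
    rw [div_mul_eq_mul_div, div_le_div_iff₀ (by positivity) (by positivity)]
    nlinarith [mul_nonneg (sq_nonneg ‖g xp‖) hlampos.le]
  linarith
end

section
/- Assume f is convex, let m ≥ 1 and M ≥ 3·m·L. Let x_0, x_1, …, x_m ∈ E be such that ∇f(x_k) ≠ 0 for 0 ≤ k ≤ m−1 and, for each 0 ≤ k ≤ m−1, x_{k+1} is the regularized lazy Newton step from x_k with Hessian snapshot x_0 and regularization λ_k := √(M·‖∇f(x_k)‖). Then f(x_0) − f(x_m) ≥ (9/(244·√M)) · ∑_{k=1}^{m} ‖∇f(x_k)‖² / ‖∇f(x_{k−1})‖^{1/2}. -/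
open scoped InnerProductSpace

section NewtonStep

variable {E : Type*} [NormedAddCommGroup E] [InnerProductSpace ℝ E]

/-- First-order lower bound for a function whose Hessian is positive semidefinite. -/
lemma inner_gradient_le_sub_of_hessian_nonneg [CompleteSpace E]
    {f : E → ℝ} {g : E → E} {H : E → E →L[ℝ] E}
    (hg : ∀ y, HasGradientAt f (g y) y) (hH : ∀ y, HasFDerivAt g (H y) y)
    (hconv : ∀ y h, 0 ≤ ⟪H y h, h⟫_ℝ) (x y : E) :
    ⟪g y, x - y⟫_ℝ ≤ f x - f y := by
  have hline (t : ℝ) : HasDerivAt (fun s : ℝ => y + s • (x - y)) (x - y) t := by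
    simpa using ((hasDerivAt_id t).smul_const (x - y)).const_add y
  have hf' (t : ℝ) : HasDerivAt (fun s : ℝ => f (y + s • (x - y)))
      ⟪g (y + t • (x - y)), x - y⟫_ℝ t := by
    simpa [Function.comp_def] using (hg _).hasFDerivAt.comp_hasDerivAt t (hline t)
  have hg' (t : ℝ) : HasDerivAt (fun s : ℝ => ⟪g (y + s • (x - y)), x - y⟫_ℝ)
      ⟪H (y + t • (x - y)) (x - y), x - y⟫_ℝ t := by
    simpa using ((hH _).comp_hasDerivAt t (hline t)).inner ℝ (hasDerivAt_const t (x - y))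
  have hmono : Monotone fun s : ℝ => ⟪g (y + s • (x - y)), x - y⟫_ℝ :=
    monotone_of_hasDerivAt_nonneg hg' fun t => hconv _ _
  obtain ⟨c, hc, hslope⟩ := exists_hasDerivAt_eq_slope _ _ zero_lt_one
    (fun t _ => (hf' t).continuousAt.continuousWithinAt) (fun t _ => hf' t)
  have hle := hmono hc.1.le
  simp at hle hslope
  linarith

/-- Linearization error of the gradient for a Hessian frozen at `z`. -/
lemma norm_gradient_sub_sub_hessian_le
    {g : E → E} {H : E → E →L[ℝ] E} {L : ℝ} (hL : 0 ≤ L)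
    (hH : ∀ y, HasFDerivAt g (H y) y)
    (hLip : ∀ y₁ y₂, ‖H y₁ - H y₂‖ ≤ L * ‖y₁ - y₂‖) (x y z : E) :
    ‖g y - g x - H z (y - x)‖ ≤ L * (‖x - z‖ + ‖y - x‖) * ‖y - x‖ := by
  refine (convex_segment x y).norm_image_sub_le_of_norm_hasFDerivWithin_le'
    (fun w _ => (hH w).hasFDerivWithinAt) (fun w hw => ?_)
    (left_mem_segment ℝ x y) (right_mem_segment ℝ x y)
  have hwx : ‖w - x‖ ≤ ‖y - x‖ := norm_sub_le_of_mem_segment hw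
  have hwz : ‖w - z‖ ≤ ‖w - x‖ + ‖x - z‖ := norm_sub_le_norm_sub_add_norm_sub w x z
  exact (hLip w z).trans (by gcongr; linarith)

/-- A regularized Newton step with positive semidefinite `A` has length at most `‖v‖ / lam`. -/
lemma mul_norm_le_of_regularized_step {A : E →L[ℝ] E} (hA : ∀ h, 0 ≤ ⟪A h, h⟫_ℝ)
    {v h : E} {lam : ℝ} (hstep : v + A h + lam • h = 0) :
    lam * ‖h‖ ≤ ‖v‖ := by
  rcases eq_or_ne h 0 with rfl | hh
  · simp
  have hpos : 0 < ‖h‖ := norm_pos_iff.2 hh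
  have hinner : ⟪v, h⟫_ℝ + ⟪A h, h⟫_ℝ + lam * ‖h‖ ^ 2 = 0 := by
    simpa [inner_add_left, real_inner_smul_left, real_inner_self_eq_norm_sq] using
      congrArg (fun u => ⟪u, h⟫_ℝ) hstep
  have hcs : -⟪v, h⟫_ℝ ≤ ‖v‖ * ‖h‖ := (neg_le_abs _).trans (abs_real_inner_le_norm v h)
  have := hA h
  exact le_of_mul_le_mul_right (by nlinarith) hpos

/-- Completing the square: if `w + lam • h` is small, then `-h` is aligned with `w`. -/
lemma inner_neg_ge_of_norm_add_smul_le {w h : E} {lam e : ℝ} (hlam : 0 < lam)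
    (he : ‖w + lam • h‖ ≤ e) :
    ‖w‖ ^ 2 / (2 * lam) + lam * ‖h‖ ^ 2 / 2 - e ^ 2 / (2 * lam) ≤ ⟪w, -h⟫_ℝ := by
  have hsq : ‖w + lam • h‖ ^ 2 = ‖w‖ ^ 2 + 2 * (lam * ⟪w, h⟫_ℝ) + lam ^ 2 * ‖h‖ ^ 2 := by
    rw [norm_add_sq_real, real_inner_smul_right, norm_smul, mul_pow, Real.norm_eq_abs, sq_abs]
  have hle : ‖w + lam • h‖ ^ 2 ≤ e ^ 2 := by gcongr
  have hdiv : ‖w‖ ^ 2 / (2 * lam) + lam * ‖h‖ ^ 2 / 2 - e ^ 2 / (2 * lam)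
      = (‖w‖ ^ 2 + lam ^ 2 * ‖h‖ ^ 2 - e ^ 2) / (2 * lam) := by
    field_simp
  rw [inner_neg_right, hdiv, div_le_iff₀ (by positivity)]
  linarith

/-- Decrease of a convex function along one gradient-regularized lazy Newton step, when the
snapshot is within `S - ‖y - x‖` of `x`. -/
lemma regularized_lazy_step_decrease [CompleteSpace E]
    {f : E → ℝ} {g : E → E} {H : E → E →L[ℝ] E} {L : ℝ} (hL : 0 ≤ L)
    (hg : ∀ y, HasGradientAt f (g y) y) (hH : ∀ y, HasFDerivAt g (H y) y)
    (hLip : ∀ y₁ y₂, ‖H y₁ - H y₂‖ ≤ L * ‖y₁ - y₂‖)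
    (hconv : ∀ y h, 0 ≤ ⟪H y h, h⟫_ℝ)
    {M S : ℝ} (hM : 0 < M) {x y z : E} (hx : g x ≠ 0)
    (hS : ‖x - z‖ + ‖y - x‖ ≤ S)
    (hstep : g x + H z (y - x) + Real.sqrt (M * ‖g x‖) • (y - x) = 0) :
    ‖g y‖ ^ 2 / (2 * Real.sqrt (M * ‖g x‖)) + M / 2 * ‖y - x‖ ^ 3
      - (L * S) ^ 2 / (2 * M) * ‖y - x‖ ≤ f x - f y := by
  have hgx : 0 < ‖g x‖ := norm_pos_iff.2 hx
  set lam := Real.sqrt (M * ‖g x‖)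
  have hlam : 0 < lam := Real.sqrt_pos.2 (by positivity)
  have hlamsq : lam ^ 2 = M * ‖g x‖ := Real.sq_sqrt (by positivity)
  have hr : M * ‖y - x‖ ≤ lam := by
    have hlen := mul_norm_le_of_regularized_step (hconv z) hstep
    refine le_of_mul_le_mul_right ?_ hlam
    nlinarith
  have hres : ‖g y + lam • (y - x)‖ ≤ L * S * ‖y - x‖ := by
    have heq : g y + lam • (y - x) = g y - g x - H z (y - x) := by
      rw [← sub_eq_zero, ← hstep]
      abel
    rw [heq]
    exact (norm_gradient_sub_sub_hessian_le hL hH hLip x y z).trans (by gcongr)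
  have hinner := inner_neg_ge_of_norm_add_smul_le hlam hres
  rw [neg_sub] at hinner
  have hdec := inner_gradient_le_sub_of_hessian_nonneg hg hH hconv x y
  have hcube : M / 2 * ‖y - x‖ ^ 3 ≤ lam * ‖y - x‖ ^ 2 / 2 := by
    nlinarith [mul_le_mul_of_nonneg_right hr (sq_nonneg ‖y - x‖)]
  have herr : (L * S * ‖y - x‖) ^ 2 / (2 * lam) ≤ (L * S) ^ 2 / (2 * M) * ‖y - x‖ := by
    rw [div_mul_eq_mul_div, div_le_div_iff₀ (by positivity) (by positivity)]
    have : 0 ≤ 2 * (L * S) ^ 2 * ‖y - x‖ := by positivity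
    nlinarith [mul_le_mul_of_nonneg_left hr this]
  linarith

end NewtonStep

theorem grad_reg_newton_phase_progress
    {E : Type*} [NormedAddCommGroup E] [InnerProductSpace ℝ E] [FiniteDimensional ℝ E]
    (f : E → ℝ) (g : E → E) (H : E → E →L[ℝ] E) (L : ℝ)
    (hL : 0 < L) (hf : ContDiff ℝ 2 f)
    (hg : ∀ y, HasGradientAt f (g y) y)
    (hH : ∀ y, HasFDerivAt g (H y) y)
    (hsym : ∀ y u v, ⟪H y u, v⟫_ℝ = ⟪u, H y v⟫_ℝ)
    (hLip : ∀ y₁ y₂, ‖H y₁ - H y₂‖ ≤ L * ‖y₁ - y₂‖)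
    (hconv : ∀ y h, 0 ≤ ⟪H y h, h⟫_ℝ)
    (m : ℕ) (hm : 1 ≤ m) (M : ℝ) (hM : 3 * (m : ℝ) * L ≤ M) (x : ℕ → E)
    (hgrad : ∀ k < m, g (x k) ≠ 0)
    (hstep : ∀ k < m,
      g (x k) + H (x 0) (x (k + 1) - x k)
        + Real.sqrt (M * ‖g (x k)‖) • (x (k + 1) - x k) = 0) :
    f (x 0) - f (x m) ≥
      9 / (244 * Real.sqrt M) *
        ∑ k ∈ Finset.Icc 1 m, ‖g (x k)‖ ^ 2 / ‖g (x (k - 1))‖ ^ ((1 : ℝ) / 2) := by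
  have hmpos : (0 : ℝ) < m := by exact_mod_cast hm
  have hMpos : 0 < M := lt_of_lt_of_le (by positivity) hM
  set r : ℕ → ℝ := fun k => ‖x (k + 1) - x k‖
  set S := ∑ k ∈ Finset.range m, r k with hS
  have hS0 : 0 ≤ S := Finset.sum_nonneg fun k _ => norm_nonneg _
  have hdist (k : ℕ) (hk : k < m) : ‖x k - x 0‖ + r k ≤ S := by
    have hpath : ‖x k - x 0‖ ≤ ∑ i ∈ Finset.range k, r i := by
      simpa [r, dist_eq_norm, norm_sub_rev] using dist_le_range_sum_dist x k
    calc ‖x k - x 0‖ + r k ≤ ∑ i ∈ Finset.range (k + 1), r i := by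
          rw [Finset.sum_range_succ]; gcongr
      _ ≤ S := Finset.sum_le_sum_of_subset_of_nonneg
          (Finset.range_mono hk) fun i _ _ => norm_nonneg _
  have hdec : ∑ k ∈ Finset.range m, (‖g (x (k + 1))‖ ^ 2 / (2 * Real.sqrt (M * ‖g (x k)‖))
      + M / 2 * r k ^ 3 - (L * S) ^ 2 / (2 * M) * r k) ≤ f (x 0) - f (x m) := by
    rw [← Finset.sum_range_sub' (fun k => f (x k))]
    refine Finset.sum_le_sum fun k hk => ?_
    rw [Finset.mem_range] at hk
    exact regularized_lazy_step_decrease hL.le hg hH hLip hconv hMpos (hgrad k hk)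
      (hdist k hk) (hstep k hk)
  rw [Finset.sum_sub_distrib, Finset.sum_add_distrib, ← Finset.mul_sum, ← Finset.mul_sum,
    ← hS] at hdec
  have hpow : S ^ 3 / (m : ℝ) ^ 2 ≤ ∑ k ∈ Finset.range m, r k ^ 3 := by
    simpa using pow_sum_div_card_le_sum_pow (s := Finset.range m) (f := r)
      (fun k _ => norm_nonneg _) 2
  have herr : (L * S) ^ 2 / (2 * M) * S ≤ M / 2 * ∑ k ∈ Finset.range m, r k ^ 3 := by
    refine le_trans ?_ (mul_le_mul_of_nonneg_left hpow (by positivity))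
    have hmL : m * L ≤ M := by nlinarith [mul_pos hmpos hL]
    have hsq : (m * L) ^ 2 ≤ M ^ 2 := by gcongr
    have hS3 : 0 ≤ S ^ 3 := by positivity
    rw [div_mul_div_comm, div_mul_eq_mul_div, div_le_div_iff₀ (by positivity) (by positivity)]
    nlinarith [mul_le_mul_of_nonneg_left hsq hS3]
  have hreindex : ∑ k ∈ Finset.Icc 1 m, ‖g (x k)‖ ^ 2 / ‖g (x (k - 1))‖ ^ ((1 : ℝ) / 2)
      = ∑ k ∈ Finset.range m, ‖g (x (k + 1))‖ ^ 2 / Real.sqrt ‖g (x k)‖ := by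
    rw [← Finset.Ico_add_one_right_eq_Icc, Finset.sum_Ico_eq_sum_range]
    simp [add_comm 1, Real.sqrt_eq_rpow]
  rw [hreindex, ge_iff_le, Finset.mul_sum]
  refine le_trans (Finset.sum_le_sum fun k _ => ?_) (by linarith : ∑ k ∈ Finset.range m,
    ‖g (x (k + 1))‖ ^ 2 / (2 * Real.sqrt (M * ‖g (x k)‖)) ≤ _)
  rw [Real.sqrt_mul hMpos.le]
  calc 9 / (244 * √M) * (‖g (x (k + 1))‖ ^ 2 / √‖g (x k)‖)
      = 9 / 244 * (‖g (x (k + 1))‖ ^ 2 / (√M * √‖g (x k)‖)) := by ring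
    _ ≤ 1 / 2 * (‖g (x (k + 1))‖ ^ 2 / (√M * √‖g (x k)‖)) := by
          refine mul_le_mul_of_nonneg_right (by norm_num) (by positivity)
    _ = ‖g (x (k + 1))‖ ^ 2 / (2 * (√M * √‖g (x k)‖)) := by ring
end

section
/- Let m ≥ 1 be an integer, π(k) := k − (k mod m), and let s : ℕ → ℝ be a sequence of nonnegative reals with s_0 ≤ 1/4 and s_{k+1} ≤ s_k² + s_k·s_{π(k)} for all k ≥ 0. Then for all integers t ≥ 0 and 0 ≤ i ≤ m: s_{t·m + i} ≤ (1/2)^{(1 + i)·(1 + m)^t + 1}. -/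
open scoped InnerProductSpace

theorem sq_add_mul_le_half_pow {a b : ℝ} {i P : ℕ} (ha : 0 ≤ a) (hb : 0 ≤ b)
    (haP : a ≤ (1 / 2 : ℝ) ^ ((1 + i) * P + 1)) (hbP : b ≤ (1 / 2 : ℝ) ^ (P + 1)) :
    a ^ 2 + a * b ≤ (1 / 2 : ℝ) ^ ((1 + (i + 1)) * P + 1) := by
  have hmono : (1 / 2 : ℝ) ^ ((1 + i) * P + 1) ≤ (1 / 2 : ℝ) ^ (P + 1) :=
    pow_le_pow_of_le_one (by norm_num) (by norm_num) (by nlinarith [Nat.zero_le (i * P)])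
  calc a ^ 2 + a * b = a * (a + b) := by ring
    _ ≤ (1 / 2 : ℝ) ^ ((1 + i) * P + 1) * ((1 / 2 : ℝ) ^ (P + 1) + (1 / 2 : ℝ) ^ (P + 1)) := by
      gcongr
      exact haP.trans hmono
    _ = (1 / 2 : ℝ) ^ ((1 + (i + 1)) * P + 1) := by
      rw [show (1 + (i + 1)) * P + 1 = ((1 + i) * P + 1) + P by ring, pow_add _ _ P, pow_succ _ P]
      ring

theorem lazy_recursion_superlinear (m : ℕ) (hm : 1 ≤ m) (s : ℕ → ℝ)
    (hpos : ∀ k, 0 ≤ s k) (h0 : s 0 ≤ 1 / 4)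
    (hrec : ∀ k : ℕ, s (k + 1) ≤ s k ^ 2 + s k * s (k - k % m)) :
    ∀ t : ℕ, ∀ i ≤ m, s (t * m + i) ≤ (1 / 2 : ℝ) ^ ((1 + i) * (1 + m) ^ t + 1) := by
  have block (t : ℕ) (ht : s (t * m) ≤ (1 / 2 : ℝ) ^ ((1 + m) ^ t + 1)) :
      ∀ i ≤ m, s (t * m + i) ≤ (1 / 2 : ℝ) ^ ((1 + i) * (1 + m) ^ t + 1) := by
    intro i
    induction i with
    | zero => intro _; simpa using ht
    | succ i ih =>
      intro hi
      have hfloor : t * m + i - (t * m + i) % m = t * m := by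
        rw [Nat.mul_add_mod_self_right, Nat.mod_eq_of_lt hi, Nat.add_sub_cancel]
      have hstep := hrec (t * m + i)
      rw [hfloor] at hstep
      exact hstep.trans
        (sq_add_mul_le_half_pow (hpos _) (hpos _) (ih (Nat.le_of_succ_le hi)) ht)
  intro t
  apply block
  induction t with
  | zero => norm_num at h0 ⊢; exact h0
  | succ t ih =>
    have hlast := block t ih m le_rfl
    rwa [← Nat.succ_mul, ← pow_succ'] at hlast
end

section
/- Assume f is strongly convex with parameter μ > 0 and attains its minimum at x⋆ (so ∇f(x⋆) = 0). Let x, z ∈ E with ∇f(x) ≠ 0, let M ≥ 0, set λ := √(M·‖∇f(x)‖), and let x⁺ be the regularized lazy Newton step from x with Hessian snapshot z and regularization λ. Then ‖∇f(x⁺)‖ ≤ (3L/(2·μ²))·‖∇f(x)‖² + (√M/μ)·‖∇f(x)‖^{3/2} + (L/μ²)·‖∇f(x)‖·‖∇f(z)‖. -/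
open scoped InnerProductSpace

section

variable {E : Type*} [NormedAddCommGroup E]

/-- First-order Taylor estimate for a map with Lipschitz derivative. -/
theorem norm_sub_sub_fderiv_apply_le_of_lipschitz [NormedSpace ℝ E]
    {g : E → E} {H : E → E →L[ℝ] E} {L : ℝ} (hH : ∀ y, HasFDerivAt g (H y) y)
    (hLip : ∀ y₁ y₂, ‖H y₁ - H y₂‖ ≤ L * ‖y₁ - y₂‖) (x d : E) :
    ‖g (x + d) - g x - H x d‖ ≤ L / 2 * ‖d‖ ^ 2 := by
  have hline (t : ℝ) : HasDerivAt (fun t : ℝ => x + t • d) d t := by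
    simpa using ((hasDerivAt_id t).smul_const d).const_add x
  have hψ (t : ℝ) : HasDerivAt (fun t : ℝ => g (x + t • d) - g x - t • H x d)
      (H (x + t • d) d - H x d) t := by
    exact ((((hH (x + t • d)).comp_hasDerivAt t (hline t)).sub_const (g x)).sub
      ((hasDerivAt_id t).smul_const (H x d))).congr_deriv (by simp)
  have hB (t : ℝ) : HasDerivAt (fun t : ℝ => L / 2 * ‖d‖ ^ 2 * t ^ 2) (L * ‖d‖ ^ 2 * t) t := by
    refine ((hasDerivAt_pow 2 t).const_mul (L / 2 * ‖d‖ ^ 2)).congr_deriv ?_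
    norm_num
    ring
  have key := image_norm_le_of_norm_deriv_right_le_deriv_boundary (a := 0) (b := 1)
    (fun t _ => (hψ t).continuousAt.continuousWithinAt)
    (fun t _ => (hψ t).hasDerivWithinAt) (by simp) hB
    (fun t ht => by
      rw [← sub_apply]
      calc ‖(H (x + t • d) - H x) d‖ ≤ ‖H (x + t • d) - H x‖ * ‖d‖ :=
            ContinuousLinearMap.le_opNorm _ _
        _ ≤ L * ‖x + t • d - x‖ * ‖d‖ := by gcongr; exact hLip _ _
        _ = L * ‖d‖ ^ 2 * t := by
            rw [add_sub_cancel_left, norm_smul, Real.norm_of_nonneg ht.1]; ring)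
    (Set.right_mem_Icc.mpr zero_le_one)
  simpa using key

variable [InnerProductSpace ℝ E]

/-- A lower bound on `⟪w, v⟫` quadratic in `v` bounds `v` linearly by `w`. -/
theorem mul_norm_le_norm_of_mul_sq_le_inner {μ : ℝ} {v w : E}
    (h : μ * ‖v‖ ^ 2 ≤ ⟪w, v⟫_ℝ) : μ * ‖v‖ ≤ ‖w‖ := by
  rcases (norm_nonneg v).eq_or_lt with hv | hv
  · rw [← hv, mul_zero]
    exact norm_nonneg w
  · refine le_of_mul_le_mul_right ?_ hv
    linarith [real_inner_le_norm w v, pow_two ‖v‖]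

/-- A map whose derivative is uniformly coercive is strongly monotone. -/
theorem mul_sq_le_inner_sub_of_coercive_fderiv {g : E → E} {H : E → E →L[ℝ] E} {μ : ℝ}
    (hH : ∀ y, HasFDerivAt g (H y) y) (hsc : ∀ y h, μ * ‖h‖ ^ 2 ≤ ⟪H y h, h⟫_ℝ) (x y : E) :
    μ * ‖y - x‖ ^ 2 ≤ ⟪g y - g x, y - x⟫_ℝ := by
  have hline (t : ℝ) : HasDerivAt (fun t : ℝ => x + t • (y - x)) (y - x) t := by
    simpa using ((hasDerivAt_id t).smul_const (y - x)).const_add x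
  have hφ (t : ℝ) : HasDerivAt (fun t : ℝ => ⟪g (x + t • (y - x)), y - x⟫_ℝ)
      ⟪H (x + t • (y - x)) (y - x), y - x⟫_ℝ t := by
    simpa using ((hH (x + t • (y - x))).comp_hasDerivAt t (hline t)).inner ℝ
      (hasDerivAt_const t (y - x))
  obtain ⟨t, -, ht⟩ := exists_hasDerivAt_eq_slope _ _ zero_lt_one
    (fun t _ => (hφ t).continuousAt.continuousWithinAt) (fun t _ => hφ t)
  have h := hsc (x + t • (y - x)) (y - x)
  rw [ht] at h
  simpa [inner_sub_left] using h

end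

theorem grad_reg_local_grad_bound
    {E : Type*} [NormedAddCommGroup E] [InnerProductSpace ℝ E] [FiniteDimensional ℝ E]
    (f : E → ℝ) (g : E → E) (H : E → E →L[ℝ] E) (L : ℝ)
    (hL : 0 < L) (hf : ContDiff ℝ 2 f)
    (hg : ∀ y, HasGradientAt f (g y) y)
    (hH : ∀ y, HasFDerivAt g (H y) y)
    (hsym : ∀ y u v, ⟪H y u, v⟫_ℝ = ⟪u, H y v⟫_ℝ)
    (hLip : ∀ y₁ y₂, ‖H y₁ - H y₂‖ ≤ L * ‖y₁ - y₂‖)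
    (μ : ℝ) (hμ : 0 < μ)
    (hsc : ∀ y h, μ * ‖h‖ ^ 2 ≤ ⟪H y h, h⟫_ℝ)
    (xstar : E) (hmin : ∀ y, f xstar ≤ f y) (hgstar : g xstar = 0)
    (x z xp : E) (hgx : g x ≠ 0) (M : ℝ) (hM : 0 ≤ M) (lam : ℝ)
    (hlam : lam = Real.sqrt (M * ‖g x‖))
    (hstep : g x + H z (xp - x) + lam • (xp - x) = 0) :
    ‖g xp‖ ≤ 3 * L / (2 * μ ^ 2) * ‖g x‖ ^ 2 + Real.sqrt M / μ * ‖g x‖ ^ ((3 : ℝ) / 2)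
      + L / μ ^ 2 * ‖g x‖ * ‖g z‖ := by
  have hdist (y : E) : ‖y - xstar‖ ≤ ‖g y‖ / μ := by
    rw [le_div_iff₀' hμ]
    have h := mul_sq_le_inner_sub_of_coercive_fderiv hH hsc xstar y
    rw [hgstar, sub_zero] at h
    exact mul_norm_le_norm_of_mul_sq_le_inner h
  have hlam0 : 0 ≤ lam := hlam ▸ Real.sqrt_nonneg _
  obtain ⟨d, rfl⟩ : ∃ d, xp = x + d := ⟨xp - x, by abel⟩
  rw [add_sub_cancel_left] at hstep
  have hd : ‖d‖ ≤ ‖g x‖ / μ := by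
    rw [le_div_iff₀' hμ, ← norm_neg (g x)]
    refine mul_norm_le_norm_of_mul_sq_le_inner ((hsc z d).trans ?_)
    have h : -g x = H z d + lam • d := by
      rw [neg_eq_iff_add_eq_zero, ← add_assoc, hstep]
    rw [h, inner_add_left, real_inner_smul_left, real_inner_self_eq_norm_sq]
    exact le_add_of_nonneg_right (by positivity)
  have hxz : ‖x - z‖ ≤ ‖g x‖ / μ + ‖g z‖ / μ := by
    calc ‖x - z‖ = ‖(x - xstar) - (z - xstar)‖ := by congr 1; abel
      _ ≤ ‖x - xstar‖ + ‖z - xstar‖ := norm_sub_le _ _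
      _ ≤ _ := add_le_add (hdist x) (hdist z)
  have hdecomp : g (x + d) = (g (x + d) - g x - H x d) + (H x - H z) d - lam • d := by
    rw [sub_apply, ← sub_eq_zero, ← hstep]
    abel
  have hpow : Real.sqrt M * ‖g x‖ ^ ((3 : ℝ) / 2) = lam * ‖g x‖ := by
    rw [hlam, Real.sqrt_mul hM, mul_assoc, Real.sqrt_eq_rpow ‖g x‖,
      ← Real.rpow_add_one (norm_ne_zero_iff.mpr hgx)]
    norm_num
  calc ‖g (x + d)‖
      ≤ ‖g (x + d) - g x - H x d‖ + ‖(H x - H z) d‖ + ‖lam • d‖ := by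
        conv_lhs => rw [hdecomp]
        exact (norm_sub_le _ _).trans (add_le_add_left (norm_add_le _ _) _)
    _ ≤ L / 2 * ‖d‖ ^ 2 + L * ‖x - z‖ * ‖d‖ + lam * ‖d‖ := by
        refine add_le_add (add_le_add ?_ ?_) ?_
        · exact norm_sub_sub_fderiv_apply_le_of_lipschitz hH hLip x d
        · exact (H x - H z).le_of_opNorm_le (hLip x z) d
        · rw [norm_smul, Real.norm_of_nonneg hlam0]
    _ ≤ L / 2 * (‖g x‖ / μ) ^ 2 + L * (‖g x‖ / μ + ‖g z‖ / μ) * (‖g x‖ / μ)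
        + lam * (‖g x‖ / μ) := by gcongr
    _ = _ := by
        rw [div_mul_eq_mul_div (Real.sqrt M), hpow]
        field_simp
        ring
end

section
/- Let m ≥ 1 be an integer, π(k) := k − (k mod m), and let s : ℕ → ℝ be a sequence of nonnegative reals with s_0 ≤ 1/16 and s_{k+1} ≤ (1/2)·(s_k² + s_k^{3/2}) + s_k·s_{π(k)} for all k ≥ 0. Then for all integers t ≥ 0: s_{t·m} ≤ (1/2)^{2·(1 + (1 + m/2)^t)}, and for all 0 ≤ i ≤ m: s_{t·m + i} ≤ (1/2)^{i·(1 + m/2)^t} · s_{t·m}. -/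
open scoped InnerProductSpace

/-- If `x ≤ S ≤ q² / 4` with `0 ≤ q ≤ 1`, one step of the recursion contracts `x` by `q`. -/
lemma lazy_step_le {x S q : ℝ} (hx : 0 ≤ x) (hxS : x ≤ S) (hq : 0 ≤ q) (hq1 : q ≤ 1)
    (hS : S ≤ q ^ 2 / 4) :
    1 / 2 * (x ^ 2 + x ^ ((3 : ℝ) / 2)) + x * S ≤ q * x := by
  have hpow : x ^ ((3 : ℝ) / 2) = x * √x := by
    rw [show (3 : ℝ) / 2 = 1 + 1 / 2 by norm_num,
      Real.rpow_add_of_nonneg hx (by norm_num) (by norm_num), Real.rpow_one, Real.sqrt_eq_rpow]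
  have hsqrt : √x ≤ q / 2 := Real.sqrt_le_iff.2 ⟨by positivity, by nlinarith⟩
  have hfac : 1 / 2 * (x + √x) + S ≤ q := by nlinarith
  rw [hpow]
  nlinarith [mul_le_mul_of_nonneg_left hfac hx]

/-- Contraction of a lazy recursion within the block of length `m` starting at `t * m`. -/
lemma lazy_block_le {m : ℕ} {s : ℕ → ℝ} (hpos : ∀ k, 0 ≤ s k)
    (hrec : ∀ k : ℕ,
      s (k + 1) ≤ 1 / 2 * (s k ^ 2 + s k ^ ((3 : ℝ) / 2)) + s k * s (k - k % m))
    {t : ℕ} {q : ℝ} (hq : 0 ≤ q) (hq1 : q ≤ 1) (hS : s (t * m) ≤ q ^ 2 / 4) :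
    ∀ i ≤ m, s (t * m + i) ≤ q ^ i * s (t * m) := by
  intro i
  induction i with
  | zero => simp
  | succ i ih =>
    intro hi
    have hprev := ih (by omega)
    have hxS : s (t * m + i) ≤ s (t * m) :=
      hprev.trans (mul_le_of_le_one_left (hpos _) (pow_le_one₀ hq hq1))
    have hstart : t * m + i - (t * m + i) % m = t * m := by
      rw [Nat.mul_add_mod_self_right, Nat.mod_eq_of_lt hi, Nat.add_sub_cancel]
    have hstep := hrec (t * m + i)
    rw [hstart] at hstep
    calc s (t * m + (i + 1)) ≤ q * s (t * m + i) :=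
          hstep.trans (lazy_step_le (hpos _) hxS hq hq1 hS)
      _ ≤ q * (q ^ i * s (t * m)) := mul_le_mul_of_nonneg_left hprev hq
      _ = q ^ (i + 1) * s (t * m) := by ring

theorem lazy_recursion_superlinear_gr (m : ℕ) (hm : 1 ≤ m) (s : ℕ → ℝ)
    (hpos : ∀ k, 0 ≤ s k) (h0 : s 0 ≤ 1 / 16)
    (hrec : ∀ k : ℕ,
      s (k + 1) ≤ 1 / 2 * (s k ^ 2 + s k ^ ((3 : ℝ) / 2)) + s k * s (k - k % m)) :
    ∀ t : ℕ,
      s (t * m) ≤ (1 / 2 : ℝ) ^ ((2 * (1 + (1 + (m : ℝ) / 2) ^ t) : ℝ)) ∧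
      ∀ i ≤ m, s (t * m + i) ≤ (1 / 2 : ℝ) ^ (((i : ℝ) * (1 + (m : ℝ) / 2) ^ t : ℝ)) * s (t * m) := by
  have block (t : ℕ)
      (ht : s (t * m) ≤ (1 / 2 : ℝ) ^ ((2 * (1 + (1 + (m : ℝ) / 2) ^ t) : ℝ))) (i : ℕ)
      (hi : i ≤ m) :
      s (t * m + i) ≤ (1 / 2 : ℝ) ^ (((i : ℝ) * (1 + (m : ℝ) / 2) ^ t : ℝ)) * s (t * m) := by
    set a : ℝ := (1 + (m : ℝ) / 2) ^ t
    have ha : 0 ≤ a := by positivity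
    have hS : s (t * m) ≤ ((1 / 2 : ℝ) ^ a) ^ 2 / 4 := by
      refine ht.trans_eq ?_
      rw [show 2 * (1 + a) = (2 : ℕ) + a * (2 : ℕ) by push_cast; ring,
        Real.rpow_add (by norm_num), Real.rpow_natCast, Real.rpow_mul_natCast (by norm_num)]
      ring
    rw [mul_comm (i : ℝ), Real.rpow_mul_natCast (by norm_num)]
    exact lazy_block_le hpos hrec (by positivity)
      (Real.rpow_le_one (by norm_num) (by norm_num) ha) hS i hi
  have start (t : ℕ) :
      s (t * m) ≤ (1 / 2 : ℝ) ^ ((2 * (1 + (1 + (m : ℝ) / 2) ^ t) : ℝ)) := by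
    induction t with
    | zero =>
      rw [pow_zero, show (2 * (1 + 1) : ℝ) = (4 : ℕ) by norm_num, Real.rpow_natCast, zero_mul]
      exact h0.trans_eq (by norm_num)
    | succ t ih =>
      rw [Nat.succ_mul]
      refine ((block t ih m le_rfl).trans
        (mul_le_mul_of_nonneg_left ih (by positivity))).trans_eq ?_
      rw [← Real.rpow_add (by norm_num)]
      congr 1
      ring
  exact fun t => ⟨start t, block t (start t)⟩
end
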